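/- Let q ≥ 2 be an integer and β > q. For any constants ε > 0 and δ ∈ (0,1), there exists a constant T = T(ε, δ, β, q) such that for all sufficiently large n and any starting configuration X₀ ∈ Ω, after T steps the SW dynamics reaches, with probability at least δ, a state X_T with ‖α(X_T) − m‖_∞ ≤ ε. -/

import Mathlib

open scoped Classical
open Finset

/-- Spin configurations on `n` vertices with `q` spins. -/
abbrev Conf (n q : ℕ) := Fin n → Fin q

/-- Number of vertices assigned spin `j`. -/
def cntN {n q : ℕ} (X : Conf n q) (j : Fin q) : ℕ :=
  (Finset.univ.filter (fun v => X v = j)).card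

/-- Number of monochromatic pairs `{u,v}` (`u < v`, same spin). -/
def numMono {n q : ℕ} (σ : Conf n q) : ℕ :=
  (Finset.univ.filter (fun p : Fin n × Fin n => p.1 < p.2 ∧ σ p.1 = σ p.2)).card

/-- The mean-field `q`-state Potts measure: probability of `σ`. -/
noncomputable def pottsProb (n q : ℕ) (β : ℝ) (σ : Conf n q) : ℝ :=
  Real.exp (β / n * numMono σ) / ∑ τ : Conf n q, Real.exp (β / n * numMono τ)

/-- The set of monochromatic pairs of a configuration. -/
def monoPairs {n q : ℕ} (σ : Conf n q) : Finset (Fin n × Fin n) :=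
  Finset.univ.filter (fun p : Fin n × Fin n => p.1 < p.2 ∧ σ p.1 = σ p.2)

/-- The graph on `Fin n` whose edges are the pairs in `E`. -/
def graphOf {n : ℕ} (E : Finset (Fin n × Fin n)) : SimpleGraph (Fin n) :=
  SimpleGraph.fromRel (fun u v => (u, v) ∈ E)

/-- Number of connected components of the graph `(V, E)`. -/
noncomputable def numComps {n : ℕ} (E : Finset (Fin n × Fin n)) : ℕ :=
  Nat.card (graphOf E).ConnectedComponent

/-- One-step transition probability of the Swendsen–Wang dynamics:
percolate on monochromatic pairs with probability `p = 1 - exp (-β/n)`,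
then color each connected component uniformly at random. -/
noncomputable def swStep (n q : ℕ) (β : ℝ) (σ τ : Conf n q) : ℝ :=
  ∑ E ∈ (monoPairs σ).powerset,
    ((1 - Real.exp (-(β / n))) ^ E.card *
        Real.exp (-(β / n)) ^ ((monoPairs σ).card - E.card)) *
      (if ∀ u v : Fin n, (graphOf E).Reachable u v → τ u = τ v then
        ((q : ℝ))⁻¹ ^ numComps E else 0)

/-- `t`-step transition probability of the Swendsen–Wang dynamics. -/
noncomputable def swProb (n q : ℕ) (β : ℝ) : ℕ → Conf n q → Conf n q → ℝ
  | 0, σ, τ => if σ = τ then 1 else 0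
  | t + 1, σ, τ => ∑ η : Conf n q, swStep n q β σ η * swProb n q β t η τ

/-- Probability of observing the trajectory `ω 0, ω 1, …, ω (ℓ-1)` at times
`1, …, ℓ` for the SW dynamics started at `X₀`. -/
noncomputable def pathProb (n q : ℕ) (β : ℝ) (X₀ : Conf n q) (ℓ : ℕ)
    (ω : Fin ℓ → Conf n q) : ℝ :=
  ∏ i : Fin ℓ, swStep n q β
    (if _h : 0 < (i : ℕ) then
        ω ⟨(i : ℕ) - 1, lt_of_le_of_lt (Nat.sub_le _ _) i.isLt⟩
      else X₀) (ω i)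

/-- Total variation distance between two probability vectors on configurations. -/
noncomputable def tvDist {n q : ℕ} (f g : Conf n q → ℝ) : ℝ :=
  (∑ τ : Conf n q, |f τ - g τ|) / 2

/-- Mixing time `τ_mix(ε)` of the SW dynamics. -/
noncomputable def mixingTime (n q : ℕ) (β ε : ℝ) : ℕ :=
  sInf {t : ℕ | ∀ σ : Conf n q, tvDist (swProb n q β t σ) (pottsProb n q β) ≤ ε}

/-- `theta lam` is the unique root in `(0,1)` of `exp (-lam * x) = 1 - x`
for `lam > 1`, and `0` for `lam ≤ 1`. -/
noncomputable def theta (lam : ℝ) : ℝ :=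
  if lam ≤ 1 then 0
  else sSup {x : ℝ | x ∈ Set.Ioo (0 : ℝ) 1 ∧ Real.exp (-lam * x) = 1 - x}

/-- The drift function `F`. -/
noncomputable def F (q : ℕ) (β : ℝ) (x : ℝ) : ℝ :=
  1 / q + (1 - 1 / q) * theta (β * x) * x

/-- The unique fixed point of `F` in `(1/q, 1]` (for `β > q`). -/
noncomputable def aFix (q : ℕ) (β : ℝ) : ℝ :=
  sSup {x : ℝ | x ∈ Set.Ioc (1 / (q : ℝ)) 1 ∧ F q β x = x}

/-- The cutoff constant `c(β,q) = (2 log (1 / F'(a)))⁻¹`. -/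
noncomputable def cConst (q : ℕ) (β : ℝ) : ℝ :=
  (2 * Real.log (1 / deriv (F q β) (aFix q β)))⁻¹

/-- Fraction of vertices assigned spin `j`. -/
noncomputable def cntFrac {n q : ℕ} (X : Conf n q) : Fin q → ℝ :=
  fun j => (cntN X j : ℝ) / n

/-- The proportions vector `α(X)`: fractions of vertices of each spin,
sorted in nonincreasing order. -/
noncomputable def alphaVec {n q : ℕ} (X : Conf n q) : Fin q → ℝ :=
  fun i => cntFrac X (Tuple.sort (cntFrac X) i.rev)

/-- `ℓ∞` distance between two vectors indexed by `Fin q`. -/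
noncomputable def linf {q : ℕ} (f g : Fin q → ℝ) : ℝ :=
  ⨆ i : Fin q, |f i - g i|

/-- The vector `κ(b) = (b, (1-b)/(q-1), …, (1-b)/(q-1))`. -/
noncomputable def kappaVec (q : ℕ) (b : ℝ) : Fin q → ℝ :=
  fun i => if (i : ℕ) = 0 then b else (1 - b) / ((q : ℝ) - 1)

/-- The majority vector `m = (a, (1-a)/(q-1), …, (1-a)/(q-1))`. -/
noncomputable def mVec (q : ℕ) (β : ℝ) : Fin q → ℝ :=
  kappaVec q (aFix q β)

/-- Index of the most common spin of `X` (least such index on ties). -/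
noncomputable def domIdx {n q : ℕ} (X : Conf n q) : ℕ :=
  sInf {j : ℕ | ∃ hj : j < q, ∀ j' : Fin q, cntN X j' ≤ cntN X ⟨j, hj⟩}

/-- `α₁(X)`: fraction of vertices carrying the most common spin of `X`. -/
noncomputable def alpha1 {n q : ℕ} (X : Conf n q) : ℝ :=
  ((Finset.univ.filter (fun v : Fin n => (X v : ℕ) = domIdx X)).card : ℝ) / n

/-- `α_{1,k}(X)`: fraction of vertices of `Vk` carrying the most common spin of `X`. -/
noncomputable def alpha1In {n q : ℕ} (X : Conf n q) (Vk : Finset (Fin n)) : ℝ :=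
  ((Vk.filter (fun v => (X v : ℕ) = domIdx X)).card : ℝ) / Vk.card

/-- `P` is a partition of the vertex set into `q` classes. -/
def IsPartition {n q : ℕ} (P : Fin q → Finset (Fin n)) : Prop :=
  (∀ i j, i ≠ j → Disjoint (P i) (P j)) ∧ ∀ v : Fin n, ∃ i, v ∈ P i

/-- A `λ`-partition: a partition with all classes of size at least `λ n`. -/
def IsLamPartition {n q : ℕ} (lam : ℝ) (P : Fin q → Finset (Fin n)) : Prop :=
  IsPartition P ∧ ∀ i, lam * n ≤ ((P i).card : ℝ)

/-- Projection: `projCnt P X i j` is the number of vertices of `P i`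
assigned spin `j` in `X`. -/
def projCnt {n q : ℕ} (P : Fin q → Finset (Fin n)) (X : Conf n q) :
    Fin q → Fin q → ℕ :=
  fun i j => ((P i).filter (fun v => X v = j)).card

/-- All potential edges of the complete graph on `Fin n`. -/
def allPairs (n : ℕ) : Finset (Fin n × Fin n) :=
  Finset.univ.filter (fun p : Fin n × Fin n => p.1 < p.2)

/-- Probability of the edge set `E` under the Erdős–Rényi measure `G(n,p)`. -/
noncomputable def erProb (n : ℕ) (p : ℝ) (E : Finset (Fin n × Fin n)) : ℝ :=
  p ^ E.card * (1 - p) ^ ((allPairs n).card - E.card)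

/-- Size of the connected component of `v` in the graph `(V, E)`. -/
noncomputable def compCard {n : ℕ} (E : Finset (Fin n × Fin n)) (v : Fin n) : ℕ :=
  (Finset.univ.filter (fun u => (graphOf E).Reachable v u)).card

/-- `L₁`: size of the largest connected component. -/
noncomputable def L1 {n : ℕ} (E : Finset (Fin n × Fin n)) : ℕ :=
  Finset.univ.sup (fun v => compCard E v)

/-- Sum of the squares of the component sizes, `Σ_j L_j²`
(computed as `Σ_v |C(v)|`). -/
noncomputable def sumCompSq {n : ℕ} (E : Finset (Fin n × Fin n)) : ℕ :=
  ∑ v : Fin n, compCard E v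

/-- Expectation of `f` under the Erdős–Rényi measure `G(n,p)`. -/
noncomputable def erExp (n : ℕ) (p : ℝ) (f : Finset (Fin n × Fin n) → ℝ) : ℝ :=
  ∑ E ∈ (allPairs n).powerset, erProb n p E * f E

/-- Random-cluster weight of an edge set with parameters `q`, `p = 1 - exp (-β/n)`. -/
noncomputable def rcWeight (n q : ℕ) (β : ℝ) (E : Finset (Fin n × Fin n)) : ℝ :=
  (1 - Real.exp (-(β / n))) ^ E.card *
    Real.exp (-(β / n)) ^ ((allPairs n).card - E.card) * (q : ℝ) ^ numComps E

/-- The mean-field random-cluster measure: probability of the edge set `E`. -/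
noncomputable def rcProb (n q : ℕ) (β : ℝ) (E : Finset (Fin n × Fin n)) : ℝ :=
  rcWeight n q β E / ∑ B ∈ (allPairs n).powerset, rcWeight n q β B

/-! ### The survival mass `x * theta (β x)` -/

/-- The limiting fraction of vertices in the giant component of a spin class of density `x`. -/
noncomputable def giantMass (β x : ℝ) : ℝ := theta (β * x) * x

lemma one_sub_exp_neg_pos {y : ℝ} (hy : 0 < y) : 0 < 1 - Real.exp (-y) := by
  have : Real.exp (-y) < 1 := by simpa using hy
  linarith

lemma half_sub_le_div_one_sub_exp_sub {y z : ℝ} (hy : 0 < y) (hyz : y ≤ z) :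
    (z - y) / 2 ≤ z / (1 - Real.exp (-z)) - y / (1 - Real.exp (-y)) := by
  have key : MonotoneOn (fun y : ℝ => y / (1 - Real.exp (-y)) - y / 2) (Set.Ioi 0) := by
    have hd : ∀ x ∈ Set.Ioi (0 : ℝ), HasDerivAt (fun y : ℝ => y / (1 - Real.exp (-y)) - y / 2)
        ((1 * (1 - Real.exp (-x)) - x * (-(Real.exp (-x) * (-1)))) / (1 - Real.exp (-x)) ^ 2
          - 1 / 2) x := by
      intro x hx
      have h1 : HasDerivAt (fun y : ℝ => 1 - Real.exp (-y)) (-(Real.exp (-x) * (-1))) x := by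
        have := ((hasDerivAt_neg x).exp).const_sub 1
        exact this
      have h2 := (hasDerivAt_id x).div h1 (one_sub_exp_neg_pos hx).ne'
      exact h2.sub ((hasDerivAt_id x).div_const 2)
    apply monotoneOn_of_deriv_nonneg (convex_Ioi 0)
    · exact fun x hx => (hd x hx).continuousAt.continuousWithinAt
    · rw [interior_Ioi]
      exact fun x hx => (hd x hx).differentiableAt.differentiableWithinAt
    · rw [interior_Ioi]
      intro x hx
      rw [(hd x hx).deriv]
      have hx0 : (0 : ℝ) < x := hx
      have hs := Real.self_le_sinh_iff.mpr hx0.le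
      rw [Real.sinh_eq] at hs
      have he := Real.exp_pos (-x)
      have hee : Real.exp x * Real.exp (-x) = 1 := by rw [← Real.exp_add]; simp
      have h3 : 2 * x * Real.exp (-x) ≤ 1 - Real.exp (-x) ^ 2 := by nlinarith
      rw [sub_nonneg, le_div_iff₀ (by have := one_sub_exp_neg_pos hx0; positivity)]
      nlinarith
  have := key (Set.mem_Ioi.mpr hy) (Set.mem_Ioi.mpr (hy.trans_le hyz)) hyz
  simp only at this
  linarith

lemma one_add_half_le_div_one_sub_exp {y : ℝ} (hy : 0 < y) :
    1 + y / 2 ≤ y / (1 - Real.exp (-y)) := by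
  rw [le_div_iff₀ (one_sub_exp_neg_pos hy)]
  have key : MonotoneOn (fun y : ℝ => (1 + y / 2) * Real.exp (-y) - (1 - y / 2)) (Set.Ici 0) := by
    have hd : ∀ x : ℝ, HasDerivAt (fun y : ℝ => (1 + y / 2) * Real.exp (-y) - (1 - y / 2))
        ((1 / 2) * Real.exp (-x) + (1 + x / 2) * (Real.exp (-x) * (-1)) - (-(1 / 2))) x := by
      intro x
      have h1 : HasDerivAt (fun y : ℝ => 1 + y / 2) (1 / 2) x :=
        ((hasDerivAt_id x).div_const 2).const_add 1
      have h2 : HasDerivAt (fun y : ℝ => 1 - y / 2) (-(1 / 2)) x :=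
        ((hasDerivAt_id x).div_const 2).const_sub 1
      exact (h1.mul (hasDerivAt_neg x).exp).sub h2
    apply monotoneOn_of_deriv_nonneg (convex_Ici 0)
    · exact fun x hx => (hd x).continuousAt.continuousWithinAt
    · exact fun x hx => (hd x).differentiableAt.differentiableWithinAt
    · rw [interior_Ici]
      intro x hx
      rw [(hd x).deriv]
      have h1 := Real.add_one_le_exp x
      have he := Real.exp_pos (-x)
      have hee : Real.exp x * Real.exp (-x) = 1 := by rw [← Real.exp_add]; simp
      nlinarith
  have := key (Set.mem_Ici.mpr le_rfl) (Set.mem_Ici.mpr hy.le) hy.le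
  simp at this
  nlinarith

lemma div_one_sub_exp_inj {y z : ℝ} (hy : 0 < y) (hz : 0 < z)
    (h : y / (1 - Real.exp (-y)) = z / (1 - Real.exp (-z))) : y = z := by
  rcases le_total y z with hyz | hyz
  · have := half_sub_le_div_one_sub_exp_sub hy hyz
    linarith
  · have := half_sub_le_div_one_sub_exp_sub hz hyz
    linarith

lemma exists_theta_root {lam : ℝ} (h : 1 < lam) :
    ∃ x ∈ Set.Ioo (0 : ℝ) 1, Real.exp (-lam * x) = 1 - x := by
  have hl : 0 < lam := by linarith
  set x0 := (lam - 1) / (2 * lam) with hx0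
  have hx0p : 0 < x0 := div_pos (by linarith) (by linarith)
  have hx01 : x0 < 1 := by rw [hx0, div_lt_one (by linarith)]; linarith
  have hx0e : lam * x0 = (lam - 1) / 2 := by rw [hx0]; field_simp
  have hneg : Real.exp (-lam * x0) ≤ 1 - x0 := by
    have h1 := Real.add_one_le_exp (lam * x0)
    have hee : Real.exp (lam * x0) * Real.exp (-lam * x0) = 1 := by
      rw [← Real.exp_add]; simp
    have he := Real.exp_pos (-lam * x0)
    have h2 : (1 + lam * x0) * Real.exp (-lam * x0) ≤ 1 := by nlinarith
    have h3 : (1 : ℝ) ≤ (1 + lam * x0) * (1 - x0) := by nlinarith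
    have h4 : (0 : ℝ) < 1 + lam * x0 := by positivity
    exact le_of_mul_le_mul_left (h2.trans h3) h4
  have hc : ContinuousOn (fun x : ℝ => Real.exp (-lam * x) - (1 - x)) (Set.Icc x0 1) := by
    fun_prop
  have hiv := intermediate_value_Icc hx01.le hc
  have hmem : (0 : ℝ) ∈ Set.Icc (Real.exp (-lam * x0) - (1 - x0)) (Real.exp (-lam * 1) - (1 - 1)) :=
    ⟨by linarith, by have := Real.exp_pos (-lam * 1); linarith⟩
  obtain ⟨x, hx, hxe⟩ := hiv hmem
  simp only at hxe
  refine ⟨x, ⟨by linarith [hx.1], ?_⟩, by linarith⟩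
  have := Real.exp_pos (-lam * x)
  linarith

lemma theta_spec {lam : ℝ} (h : 1 < lam) :
    theta lam ∈ Set.Ioo (0 : ℝ) 1 ∧ Real.exp (-lam * theta lam) = 1 - theta lam := by
  obtain ⟨x, hx, hxe⟩ := exists_theta_root h
  have hset : {x : ℝ | x ∈ Set.Ioo (0 : ℝ) 1 ∧ Real.exp (-lam * x) = 1 - x} = {x} := by
    have hl : 0 < lam := by linarith
    have aux : ∀ z : ℝ, z ∈ Set.Ioo (0 : ℝ) 1 → Real.exp (-lam * z) = 1 - z →
        (lam * z) / (1 - Real.exp (-(lam * z))) = lam := by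
      intro z hz hze
      rw [← neg_mul, hze, sub_sub_cancel, mul_div_assoc, div_self hz.1.ne', mul_one]
    ext y
    constructor
    · rintro ⟨hy, hye⟩
      have := div_one_sub_exp_inj (mul_pos hl hy.1) (mul_pos hl hx.1)
        ((aux y hy hye).trans (aux x hx hxe).symm)
      exact mul_left_cancel₀ hl.ne' this
    · rintro rfl
      exact ⟨hx, hxe⟩
  have : theta lam = x := by
    unfold theta
    rw [if_neg (not_le.mpr h), hset, csSup_singleton]
  rw [this]
  exact ⟨hx, hxe⟩

lemma giantMass_eq_zero {β x : ℝ} (h : β * x ≤ 1) : giantMass β x = 0 := by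
  simp [giantMass, theta, h]

lemma giantMass_spec {β x : ℝ} (hβ : 0 < β) (h : 1 < β * x) :
    0 < giantMass β x ∧ giantMass β x < x ∧
      (β * giantMass β x) / (1 - Real.exp (-(β * giantMass β x))) = β * x := by
  obtain ⟨⟨h0, h1⟩, he⟩ := theta_spec h
  have hx : 0 < x := by
    by_contra hx
    push Not at hx
    nlinarith
  refine ⟨mul_pos h0 hx, by unfold giantMass; nlinarith, ?_⟩
  have : -(β * giantMass β x) = -(β * x) * theta (β * x) := by unfold giantMass; ring
  rw [this, he, sub_sub_cancel, div_eq_iff h0.ne']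
  unfold giantMass
  ring

lemma giantMass_eq_of_root {β x k : ℝ} (hβ : 0 < β) (hk : 0 < k)
    (h : (x - k) * Real.exp (β * k) = x) : giantMass β x = k := by
  have hy : 0 < β * k := mul_pos hβ hk
  have hee : Real.exp (β * k) * Real.exp (-(β * k)) = 1 := by rw [← Real.exp_add]; simp
  have hx : (β * k) / (1 - Real.exp (-(β * k))) = β * x := by
    rw [div_eq_iff (one_sub_exp_neg_pos hy).ne']
    have : x - k = x * Real.exp (-(β * k)) := by
      calc x - k = (x - k) * (Real.exp (β * k) * Real.exp (-(β * k))) := by rw [hee, mul_one]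
        _ = _ := by rw [← mul_assoc, h]
    linear_combination (-β) * this
  have h1 : 1 < β * x := by
    have := one_add_half_le_div_one_sub_exp hy
    rw [hx] at this
    linarith
  obtain ⟨g0, _, ge⟩ := giantMass_spec hβ h1
  have := div_one_sub_exp_inj (mul_pos hβ g0) hy (ge.trans hx.symm)
  exact mul_left_cancel₀ hβ.ne' this

lemma giantMass_nonneg {β : ℝ} (hβ : 0 < β) (x : ℝ) : 0 ≤ giantMass β x := by
  rcases le_or_gt (β * x) 1 with h | h
  · rw [giantMass_eq_zero h]
  · exact (giantMass_spec hβ h).1.le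

lemma giantMass_le_self {β x : ℝ} (hβ : 0 < β) (hx : 0 ≤ x) : giantMass β x ≤ x := by
  rcases le_or_gt (β * x) 1 with h | h
  · rwa [giantMass_eq_zero h]
  · exact (giantMass_spec hβ h).2.1.le

lemma giantMass_mono_lipschitz {β x y : ℝ} (hβ : 0 < β) (hxy : x ≤ y) :
    giantMass β x ≤ giantMass β y ∧ giantMass β y - giantMass β x ≤ 2 * (y - x) := by
  rcases le_or_gt (β * y) 1 with h | h
  · have : β * x ≤ 1 := by nlinarith
    rw [giantMass_eq_zero h, giantMass_eq_zero this]
    constructor <;> linarith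
  obtain ⟨y0, _, ye⟩ := giantMass_spec hβ h
  rcases le_or_gt (β * x) 1 with h' | h'
  · rw [giantMass_eq_zero h']
    refine ⟨y0.le, ?_⟩
    have := one_add_half_le_div_one_sub_exp (mul_pos hβ y0)
    rw [ye] at this
    have h2 : β * giantMass β y ≤ β * (2 * (y - x)) := by linarith
    have := le_of_mul_le_mul_left h2 hβ
    linarith
  obtain ⟨x0, _, xe⟩ := giantMass_spec hβ h'
  have hle : giantMass β x ≤ giantMass β y := by
    by_contra hlt
    push Not at hlt
    have := half_sub_le_div_one_sub_exp_sub (mul_pos hβ y0) (mul_le_mul_of_nonneg_left hlt.le hβ.le)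
    rw [xe, ye] at this
    nlinarith
  refine ⟨hle, ?_⟩
  have := half_sub_le_div_one_sub_exp_sub (mul_pos hβ x0) (mul_le_mul_of_nonneg_left hle hβ.le)
  rw [xe, ye] at this
  have h2 : β * (giantMass β y - giantMass β x) ≤ β * (2 * (y - x)) := by linarith
  exact le_of_mul_le_mul_left h2 hβ

lemma giantMass_monotone {β : ℝ} (hβ : 0 < β) : Monotone (giantMass β) :=
  fun _ _ h => (giantMass_mono_lipschitz hβ h).1

lemma abs_giantMass_sub_le {β : ℝ} (hβ : 0 < β) (x y : ℝ) :
    |giantMass β x - giantMass β y| ≤ 2 * |x - y| := by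
  rcases le_total x y with h | h
  · have := giantMass_mono_lipschitz hβ h
    rw [abs_sub_comm, abs_of_nonneg (by linarith), abs_sub_comm, abs_of_nonneg (by linarith)]
    exact this.2
  · have := giantMass_mono_lipschitz hβ h
    rw [abs_of_nonneg (by linarith), abs_of_nonneg (by linarith)]
    exact this.2

lemma continuous_giantMass {β : ℝ} (hβ : 0 < β) : Continuous (giantMass β) := by
  have : LipschitzWith 2 (giantMass β) := LipschitzWith.of_dist_le_mul fun x y => by
    rw [Real.dist_eq, Real.dist_eq]
    exact abs_giantMass_sub_le hβ x y
  exact this.continuous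

lemma mul_sub_giantMass_lt_one {β x : ℝ} (hβ : 0 < β) (h : 1 < β * x) :
    β * (x - giantMass β x) < 1 := by
  obtain ⟨g0, _, ge⟩ := giantMass_spec hβ h
  have hy := mul_pos hβ g0
  rw [mul_sub, ← ge, sub_lt_iff_lt_add, div_lt_iff₀ (one_sub_exp_neg_pos hy)]
  have h1 := Real.add_one_lt_exp hy.ne'
  have hee : Real.exp (β * giantMass β x) * Real.exp (-(β * giantMass β x)) = 1 := by
    rw [← Real.exp_add]; simp
  have he := Real.exp_pos (-(β * giantMass β x))
  nlinarith

lemma mul_sub_giantMass_le_one {β x : ℝ} (hβ : 0 < β) : β * (x - giantMass β x) ≤ 1 := by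
  rcases le_or_gt (β * x) 1 with h | h
  · rwa [giantMass_eq_zero h, sub_zero]
  · exact (mul_sub_giantMass_lt_one hβ h).le

lemma le_sub_mul_exp_of_le_giantMass {β x y : ℝ} (hβ : 0 < β) (hy : 0 ≤ y)
    (h : y ≤ giantMass β x) : x ≤ (x - y) * Real.exp (β * y) := by
  rcases hy.eq_or_lt with rfl | hy0
  · simp
  have h1 : 1 < β * x := by
    by_contra hc
    rw [giantMass_eq_zero (not_lt.mp hc)] at h
    linarith
  obtain ⟨g0, _, ge⟩ := giantMass_spec hβ h1
  have h2 := half_sub_le_div_one_sub_exp_sub (mul_pos hβ hy0) (mul_le_mul_of_nonneg_left h hβ.le)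
  rw [ge] at h2
  have h3 : (β * y) / (1 - Real.exp (-(β * y))) ≤ β * x := by nlinarith
  rw [div_le_iff₀ (one_sub_exp_neg_pos (mul_pos hβ hy0))] at h3
  have h4 : y ≤ x * (1 - Real.exp (-(β * y))) := by
    have : β * y ≤ β * (x * (1 - Real.exp (-(β * y)))) := by linarith
    exact le_of_mul_le_mul_left this hβ
  have hee : Real.exp (β * y) * Real.exp (-(β * y)) = 1 := by rw [← Real.exp_add]; simp
  have he := Real.exp_pos (β * y)
  nlinarith

lemma exp_neg_mul_giantMass {β x : ℝ} (hβ : 0 < β) (h : 1 < β * x) :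
    x * (1 - Real.exp (-(β * giantMass β x))) = giantMass β x := by
  obtain ⟨g0, _, ge⟩ := giantMass_spec hβ h
  rw [div_eq_iff (one_sub_exp_neg_pos (mul_pos hβ g0)).ne'] at ge
  have : β * (x * (1 - Real.exp (-(β * giantMass β x)))) = β * giantMass β x := by linarith
  exact mul_left_cancel₀ hβ.ne' this

/-- Away from `0` and from the giant mass, the defining equation fails quantitatively. -/
lemma exists_le_abs_root_defect {β η : ℝ} (hβ : 0 < β) (hη : 0 < η) :
    ∃ c > 0, ∀ x k : ℝ, 0 ≤ x → x ≤ 1 → k ≤ x → η ≤ k → η ≤ |k - giantMass β x| →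
      c ≤ |(x - k) * Real.exp (β * k) - x| := by
  set K : Set (ℝ × ℝ) := (Set.Icc (0 : ℝ) 1 ×ˢ Set.Icc (0 : ℝ) 1) ∩
    ({p | p.2 ≤ p.1} ∩ {p | η ≤ p.2} ∩ {p | η ≤ |p.2 - giantMass β p.1|}) with hK
  have hg := continuous_giantMass hβ
  have hKc : IsCompact K := by
    apply (isCompact_Icc.prod isCompact_Icc).inter_right
    apply IsClosed.inter
    · apply IsClosed.inter
      · exact isClosed_le continuous_snd continuous_fst
      · exact isClosed_le continuous_const continuous_snd
    · apply isClosed_le continuous_const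
      fun_prop
  have hmem : ∀ x k : ℝ, 0 ≤ x → x ≤ 1 → k ≤ x → η ≤ k → η ≤ |k - giantMass β x| →
      (x, k) ∈ K := fun x k h1 h2 h3 h4 h5 =>
    ⟨⟨⟨h1, h2⟩, ⟨by simp; linarith, by simp; linarith⟩⟩, ⟨h3, h4⟩, h5⟩
  have hfc : ContinuousOn (fun p : ℝ × ℝ => |(p.1 - p.2) * Real.exp (β * p.2) - p.1|) K := by
    fun_prop
  rcases K.eq_empty_or_nonempty with he | hne
  · refine ⟨1, one_pos, fun x k h1 h2 h3 h4 h5 => ?_⟩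
    have := hmem x k h1 h2 h3 h4 h5
    simp [he] at this
  · obtain ⟨p, hp, hmin⟩ := hKc.exists_isMinOn hne hfc
    refine ⟨_, ?_, fun x k h1 h2 h3 h4 h5 => hmin (hmem x k h1 h2 h3 h4 h5)⟩
    rw [gt_iff_lt, abs_pos]
    intro h0
    have hk : 0 < p.2 := hη.trans_le hp.2.1.2
    have := giantMass_eq_of_root hβ hk (sub_eq_zero.mp h0)
    have h5 : η ≤ |p.2 - giantMass β p.1| := hp.2.2
    rw [this] at h5
    simp at h5
    linarith

/-! ### The deterministic drift of the giant mass -/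

/-- The giant mass produced by a configuration in which one spin has density
`s + (1 - s) / q` and every other spin has density `(1 - s) / q`. -/
noncomputable def driftMass (q : ℕ) (β s : ℝ) : ℝ := giantMass β ((1 + ((q : ℝ) - 1) * s) / q)

lemma driftMass_monotone {q : ℕ} (hq : 2 ≤ q) {β : ℝ} (hβ : 0 < β) :
    Monotone (driftMass q β) := by
  intro s t hst
  have hq' : (2 : ℝ) ≤ q := by exact_mod_cast hq
  apply giantMass_monotone hβ
  apply div_le_div_of_nonneg_right _ (by linarith)
  nlinarith

lemma continuous_driftMass {q : ℕ} {β : ℝ} (hβ : 0 < β) : Continuous (driftMass q β) :=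
  (continuous_giantMass hβ).comp (by fun_prop)

lemma driftMass_fixed_spec {q : ℕ} (hq : 2 ≤ q) {β s : ℝ} (hβ : 0 < β) (hs : 0 < s)
    (h : driftMass q β s = s) :
    s < 1 ∧ β * s + Real.log (1 - s) - Real.log (1 + ((q : ℝ) - 1) * s) = 0 := by
  have hq' : (2 : ℝ) ≤ q := by exact_mod_cast hq
  have h1 : 1 < β * ((1 + ((q : ℝ) - 1) * s) / q) := by
    by_contra hc
    rw [driftMass, giantMass_eq_zero (not_lt.mp hc)] at h
    linarith
  have he := exp_neg_mul_giantMass hβ h1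
  have hlt := (giantMass_spec hβ h1).2.1
  change _ = driftMass q β s at he
  change driftMass q β s < _ at hlt
  change _ * (1 - Real.exp (-(β * driftMass q β s))) = _ at he
  rw [h] at he hlt
  rw [lt_div_iff₀ (by linarith)] at hlt
  have hs1 : s < 1 := by nlinarith
  refine ⟨hs1, ?_⟩
  have hA : 0 < 1 + ((q : ℝ) - 1) * s := by nlinarith
  have he2 : (1 + ((q : ℝ) - 1) * s) * Real.exp (-(β * s)) = 1 - s := by
    have hq0 : (q : ℝ) ≠ 0 := by linarith
    rw [div_mul_eq_mul_div, div_eq_iff hq0] at he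
    linarith
  rw [← he2, Real.log_mul hA.ne' (Real.exp_pos _).ne', Real.log_exp]
  ring

lemma driftMass_fixed_unique {q : ℕ} (hq : 2 ≤ q) {β s t : ℝ} (hβ : (q : ℝ) < β)
    (hs : 0 < s) (ht : 0 < t) (hfs : driftMass q β s = s) (hft : driftMass q β t = t) :
    s = t := by
  have hq' : (2 : ℝ) ≤ q := by exact_mod_cast hq
  have hβ0 : 0 < β := by linarith
  wlog hst : s < t generalizing s t
  · rcases (not_lt.mp hst).eq_or_lt with h | h
    · exact h.symm
    · exact (this ht hs hft hfs h).symm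
  exfalso
  obtain ⟨hs1, hse⟩ := driftMass_fixed_spec hq hβ0 hs hfs
  obtain ⟨ht1, hte⟩ := driftMass_fixed_spec hq hβ0 ht hft
  set ψ : ℝ → ℝ := fun s => β * s + Real.log (1 - s) - Real.log (1 + ((q : ℝ) - 1) * s) with hψ
  have hd : ∀ x : ℝ, 0 ≤ x → x < 1 → HasDerivAt ψ
      (β * 1 + (-1) / (1 - x) - (((q : ℝ) - 1) * 1) / (1 + ((q : ℝ) - 1) * x)) x := by
    intro x h0 h1
    have hA : 0 < 1 + ((q : ℝ) - 1) * x := by nlinarith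
    have e1 : HasDerivAt (fun x : ℝ => 1 - x) (-1) x := (hasDerivAt_id x).const_sub 1
    have e2 : HasDerivAt (fun x : ℝ => 1 + ((q : ℝ) - 1) * x) (((q : ℝ) - 1) * 1) x :=
      ((hasDerivAt_id x).const_mul _).const_add 1
    exact (((hasDerivAt_id x).const_mul β).add (e1.log (by linarith))).sub (e2.log hA.ne')
  have crit : ∀ x : ℝ, 0 ≤ x → x < 1 →
      β * 1 + (-1) / (1 - x) - (((q : ℝ) - 1) * 1) / (1 + ((q : ℝ) - 1) * x) = 0 →
      β * (1 + ((q : ℝ) - 1) * x) * (1 - x) = q := by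
    intro x h0 h1 h
    have hA : 1 + ((q : ℝ) - 1) * x ≠ 0 := by nlinarith
    have hB : 1 - x ≠ 0 := by linarith
    have e1 : (-1) / (1 - x) * (1 - x) = -1 := div_mul_cancel₀ _ hB
    have e2 : (((q : ℝ) - 1) * 1) / (1 + ((q : ℝ) - 1) * x) * (1 + ((q : ℝ) - 1) * x) =
        ((q : ℝ) - 1) * 1 := div_mul_cancel₀ _ hA
    linear_combination (1 + ((q : ℝ) - 1) * x) * (1 - x) * h - (1 + ((q : ℝ) - 1) * x) * e1
      + (1 - x) * e2
  have hψ0 : ψ 0 = 0 := by simp [hψ]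
  obtain ⟨x, hx, hxe⟩ := exists_hasDerivAt_eq_zero hs
    (fun y hy => (hd y hy.1 (by linarith [hy.2])).continuousAt.continuousWithinAt)
    (hψ0.trans hse.symm) (fun y hy => hd y hy.1.le (by linarith [hy.2]))
  obtain ⟨y, hy, hye⟩ := exists_hasDerivAt_eq_zero hst
    (fun y hy => (hd y (by linarith [hy.1]) (by linarith [hy.2])).continuousAt.continuousWithinAt)
    (hse.trans hte.symm) (fun y hy => hd y (by linarith [hy.1]) (by linarith [hy.2]))
  have hx' := crit x hx.1.le (by linarith [hx.2]) hxe
  have hy' := crit y (by linarith [hy.1]) (by linarith [hy.2]) hye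
  have hxy : x < y := hx.2.trans hy.1
  have hx0 := hx.1
  have key : (y - x) * (β * ((q : ℝ) - 1) * (x * y) + (β - q)) = 0 := by
    linear_combination y * hx' - x * hy'
  have : 0 < β * ((q : ℝ) - 1) * (x * y) + (β - q) := by
    have : 0 < β * ((q : ℝ) - 1) * (x * y) :=
      mul_pos (mul_pos hβ0 (by linarith)) (mul_pos hx0 (hx0.trans hxy))
    linarith
  have := mul_pos (sub_pos.mpr hxy) this
  linarith

lemma F_eq_iff {q : ℕ} (hq : 2 ≤ q) (β s : ℝ) :
    F q β ((1 + ((q : ℝ) - 1) * s) / q) = (1 + ((q : ℝ) - 1) * s) / q ↔ driftMass q β s = s := by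
  have hq' : (2 : ℝ) ≤ q := by exact_mod_cast hq
  have hq0 : (q : ℝ) ≠ 0 := by linarith
  have hq1 : (q : ℝ) - 1 ≠ 0 := by linarith
  have : F q β ((1 + ((q : ℝ) - 1) * s) / q) = (1 + ((q : ℝ) - 1) * driftMass q β s) / q := by
    unfold F driftMass giantMass
    rw [mul_assoc (1 - 1 / (q : ℝ))]
    field_simp
  rw [this, div_left_inj' hq0, add_right_inj, mul_right_inj' hq1]

lemma aFix_eq {q : ℕ} (hq : 2 ≤ q) {β s : ℝ} (hβ : (q : ℝ) < β) (hs : 0 < s)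
    (h : driftMass q β s = s) : aFix q β = (1 + ((q : ℝ) - 1) * s) / q := by
  have hq' : (2 : ℝ) ≤ q := by exact_mod_cast hq
  have hβ0 : 0 < β := by linarith
  have hq0 : (0 : ℝ) < q := by linarith
  have : {x : ℝ | x ∈ Set.Ioc (1 / (q : ℝ)) 1 ∧ F q β x = x} = {(1 + ((q : ℝ) - 1) * s) / q} := by
    ext x
    constructor
    · rintro ⟨hx, hxe⟩
      set t := (q * x - 1) / ((q : ℝ) - 1) with ht
      have hq1 : (q : ℝ) - 1 ≠ 0 := by linarith
      have hxt : x = (1 + ((q : ℝ) - 1) * t) / q := by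
        rw [ht]; field_simp; ring
      have ht0 : 0 < t := by
        apply div_pos _ (by linarith)
        have := hx.1
        rw [div_lt_iff₀ hq0] at this
        linarith
      rw [hxt, F_eq_iff hq] at hxe
      rw [Set.mem_singleton_iff, hxt, driftMass_fixed_unique hq hβ ht0 hs hxe h]
    · rintro rfl
      have hs1 := (driftMass_fixed_spec hq hβ0 hs h).1
      refine ⟨⟨?_, ?_⟩, (F_eq_iff hq β s).mpr h⟩
      · apply div_lt_div_of_pos_right _ hq0
        nlinarith
      · rw [div_le_one hq0]
        nlinarith
  rw [aFix, this, csSup_singleton]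

/-- A uniform lower bound on the total giant mass, large enough to make all
non-dominant spins subcritical. -/
lemma exists_giantMass_sum_lower_bound {q : ℕ} (hq : 2 ≤ q) {β : ℝ} (hβ : (q : ℝ) < β) :
    ∃ s₁ : ℝ, 1 - q / β < s₁ ∧ s₁ ≤ 1 ∧ ∀ x : Fin q → ℝ, (∀ i, 0 ≤ x i) → ∑ i, x i = 1 →
      s₁ ≤ ∑ i, giantMass β (x i) := by
  have hq' : (2 : ℝ) ≤ q := by exact_mod_cast hq
  have hβ0 : 0 < β := by linarith
  have hq0 : (0 : ℝ) < q := by linarith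
  have hcont : ContinuousOn (fun x => x - giantMass β x) (Set.Icc (1 / (q : ℝ)) 1) := by
    have := continuous_giantMass hβ0
    fun_prop
  have hne : (Set.Icc (1 / (q : ℝ)) 1).Nonempty :=
    ⟨1, by rw [div_le_one hq0]; linarith, le_rfl⟩
  obtain ⟨z, hz, hmax⟩ := isCompact_Icc.exists_isMaxOn hne hcont
  set m := z - giantMass β z with hm
  have hz1 : 1 < β * z := by
    have := hz.1
    rw [div_le_iff₀ hq0] at this
    have hz0 : 0 < z := by nlinarith
    nlinarith
  have hm1 : m < 1 / β := by
    rw [lt_div_iff₀ hβ0, mul_comm]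
    exact mul_sub_giantMass_lt_one hβ0 hz1
  refine ⟨1 - (q - 1) / β - m, ?_, ?_, fun x hx hsum => ?_⟩
  · have : (q : ℝ) / β = (q - 1) / β + 1 / β := by rw [← add_div]; ring_nf
    linarith
  · have h1 : 0 ≤ (q - 1) / β := div_nonneg (by linarith) hβ0.le
    have hz0 : 0 ≤ z := (by positivity : (0 : ℝ) ≤ 1 / q).trans hz.1
    have h2 : 0 ≤ m := sub_nonneg.mpr (giantMass_le_self hβ0 hz0)
    linarith
  · have hex : ∃ i, 1 / (q : ℝ) ≤ x i := by
      by_contra hc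
      push Not at hc
      have hlt : ∑ i, x i < ∑ _i : Fin q, 1 / (q : ℝ) :=
        Finset.sum_lt_sum_of_nonempty ⟨⟨0, by lia⟩, Finset.mem_univ _⟩ fun i _ => hc i
      rw [hsum] at hlt
      simp [hq0.ne'] at hlt
    obtain ⟨i, hi⟩ := hex
    have hle1 : x i ≤ 1 := by
      rw [← hsum]
      exact Finset.single_le_sum (fun j _ => hx j) (Finset.mem_univ i)
    have hmi : x i - giantMass β (x i) ≤ m := hmax ⟨hi, hle1⟩
    have hrest : ∑ j ∈ Finset.univ.erase i, (x j - giantMass β (x j)) ≤ (q - 1) / β := by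
      calc _ ≤ ∑ j ∈ Finset.univ.erase i, 1 / β := by
            apply Finset.sum_le_sum
            intro j _
            rw [le_div_iff₀ hβ0, mul_comm]
            exact mul_sub_giantMass_le_one hβ0
        _ = (q - 1) / β := by
            rw [Finset.sum_const, Finset.card_erase_of_mem (Finset.mem_univ _), Finset.card_univ,
              Fintype.card_fin, nsmul_eq_mul, Nat.cast_sub (by lia)]
            push_cast
            ring
    have hsplit := Finset.add_sum_erase Finset.univ (fun j => x j - giantMass β (x j))
      (Finset.mem_univ i)
    have hd := Finset.sum_sub_distrib (s := Finset.univ) x fun j => giantMass β (x j)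
    rw [hsum] at hd
    linarith

lemma driftMass_mem_Icc {q : ℕ} (hq : 2 ≤ q) {β s₁ s : ℝ} (hβ : (q : ℝ) < β)
    (h₁ : 1 - q / β < s₁)
    (hbound : ∀ x : Fin q → ℝ, (∀ i, 0 ≤ x i) → ∑ i, x i = 1 → s₁ ≤ ∑ i, giantMass β (x i))
    (hs : s ∈ Set.Icc s₁ 1) : driftMass q β s ∈ Set.Icc s₁ 1 := by
  have hq' : (2 : ℝ) ≤ q := by exact_mod_cast hq
  have hβ0 : 0 < β := by linarith
  have hq0 : (0 : ℝ) < q := by linarith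
  have hs0 : 0 < s := by
    have : (q : ℝ) / β < 1 := by rw [div_lt_one hβ0]; exact hβ
    linarith [hs.1]
  have hsub : giantMass β ((1 - s) / q) = 0 := by
    apply giantMass_eq_zero
    have h2 : 1 - s ≤ q / β := by linarith [hs.1]
    rw [le_div_iff₀ hβ0] at h2
    rw [← mul_div_assoc, div_le_one hq0]
    linarith
  set i₀ : Fin q := ⟨0, by lia⟩
  set x : Fin q → ℝ := fun i => if i = i₀ then (1 + ((q : ℝ) - 1) * s) / q else (1 - s) / q
  have hsumg : ∀ g : ℝ → ℝ, ∑ i, g (x i) =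
      g ((1 + ((q : ℝ) - 1) * s) / q) + (q - 1) * g ((1 - s) / q) := by
    intro g
    rw [← Finset.add_sum_erase _ _ (Finset.mem_univ i₀)]
    have hx0 : x i₀ = (1 + ((q : ℝ) - 1) * s) / q := if_pos rfl
    rw [hx0, add_right_inj, Finset.sum_congr rfl (g := fun _ => g ((1 - s) / q)), Finset.sum_const,
      Finset.card_erase_of_mem (Finset.mem_univ _), Finset.card_univ, Fintype.card_fin,
      nsmul_eq_mul, Nat.cast_sub (by lia)]
    · push_cast; ring
    · intro i hi
      simp [x, Finset.ne_of_mem_erase hi]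
  have hx : ∀ i, 0 ≤ x i := by
    intro i
    simp only [x]
    split_ifs
    · exact div_nonneg (by nlinarith) hq0.le
    · exact div_nonneg (by linarith [hs.2]) hq0.le
  have hsum1 : ∑ i, x i = 1 := by
    have := hsumg id
    simp only [id] at this
    rw [this]
    field_simp
    ring
  have := hbound x hx hsum1
  rw [hsumg, hsub, mul_zero, add_zero] at this
  refine ⟨this, (giantMass_le_self hβ0 (div_nonneg (by nlinarith) hq0.le)).trans ?_⟩
  rw [div_le_one hq0]
  nlinarith [hs.2]

/-- The iterates of the drift converge uniformly to the value attached to the fixed point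
`aFix q β`. -/
lemma exists_iterate_driftMass_close {q : ℕ} (hq : 2 ≤ q) {β s₁ : ℝ} (hβ : (q : ℝ) < β)
    (h₁ : 1 - q / β < s₁) (h₁' : s₁ ≤ 1)
    (hbound : ∀ x : Fin q → ℝ, (∀ i, 0 ≤ x i) → ∑ i, x i = 1 → s₁ ≤ ∑ i, giantMass β (x i)) :
    ∃ s : ℝ, 0 < s ∧ s < 1 ∧ aFix q β = (1 + ((q : ℝ) - 1) * s) / q ∧
      ∀ ε > 0, ∃ T : ℕ, ∀ t ∈ Set.Icc s₁ 1, |(driftMass q β)^[T] t - s| ≤ ε := by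
  have hq' : (2 : ℝ) ≤ q := by exact_mod_cast hq
  have hβ0 : 0 < β := by linarith
  have hq0 : (0 : ℝ) < q := by linarith
  have hs0 : 0 < s₁ := by
    have : (q : ℝ) / β < 1 := by rw [div_lt_one hβ0]; exact hβ
    linarith
  set f := driftMass q β with hf
  have hmono : Monotone f := driftMass_monotone hq hβ0
  have hcont : Continuous f := continuous_driftMass hβ0
  have hmaps : Set.MapsTo f (Set.Icc s₁ 1) (Set.Icc s₁ 1) := fun s hs =>
    driftMass_mem_Icc hq hβ h₁ hbound hs
  have hitm : ∀ t, ∀ s ∈ Set.Icc s₁ 1, f^[t] s ∈ Set.Icc s₁ 1 := fun t s hs => hmaps.iterate t hs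
  have hl : s₁ ∈ Set.Icc s₁ 1 := ⟨le_rfl, h₁'⟩
  have hr : (1 : ℝ) ∈ Set.Icc s₁ 1 := ⟨h₁', le_rfl⟩
  have hup : Monotone fun t => f^[t] s₁ := hmono.monotone_iterate_of_le_map (hmaps hl).1
  have hdown : Antitone fun t => f^[t] 1 := hmono.antitone_iterate_of_map_le (hmaps hr).2
  have htu := tendsto_atTop_ciSup hup ⟨1, by rintro _ ⟨t, rfl⟩; exact (hitm t _ hl).2⟩
  have htd := tendsto_atTop_ciInf hdown ⟨s₁, by rintro _ ⟨t, rfl⟩; exact (hitm t _ hr).1⟩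
  set su := ⨆ t, f^[t] s₁
  set sd := ⨅ t, f^[t] 1
  have hsu : f su = su := isFixedPt_of_tendsto_iterate htu hcont.continuousAt
  have hsd : f sd = sd := isFixedPt_of_tendsto_iterate htd hcont.continuousAt
  have hsu0 : 0 < su := hs0.trans_le (ge_of_tendsto' htu fun t => (hitm t _ hl).1)
  have hsd0 : 0 < sd := hs0.trans_le (ge_of_tendsto' htd fun t => (hitm t _ hr).1)
  have heq : sd = su := driftMass_fixed_unique hq hβ hsd0 hsu0 hsd hsu
  rw [heq] at htd
  refine ⟨su, hsu0, (driftMass_fixed_spec hq hβ0 hsu0 hsu).1, aFix_eq hq hβ hsu0 hsu,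
    fun ε hε => ?_⟩
  have e1 := Metric.tendsto_atTop.mp htu ε hε
  have e2 := Metric.tendsto_atTop.mp htd ε hε
  obtain ⟨T1, hT1⟩ := e1
  obtain ⟨T2, hT2⟩ := e2
  refine ⟨max T1 T2, fun t ht => ?_⟩
  have a1 := hT1 (max T1 T2) (le_max_left _ _)
  have a2 := hT2 (max T1 T2) (le_max_right _ _)
  rw [Real.dist_eq, abs_lt] at a1 a2
  have b1 := hmono.iterate (max T1 T2) ht.1
  have b2 := hmono.iterate (max T1 T2) ht.2
  rw [abs_le]
  constructor <;> linarith [a1.1, a2.2]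

/-! ### Bernoulli percolation on a finite edge set -/

/-- Expectation of `f` under percolation on `B` in which every edge is closed with
probability `r`, independently. -/
noncomputable def perc {α : Type*} (r : ℝ) (B : Finset α) (f : Finset α → ℝ) : ℝ :=
  ∑ E ∈ B.powerset, ((1 - r) ^ E.card * r ^ (B.card - E.card)) * f E

section perc
variable {α : Type*} {r : ℝ} {A B : Finset α} {f g : Finset α → ℝ}

lemma perc_union [DecidableEq α] (h : Disjoint A B) :
    perc r (A ∪ B) f = perc r A fun E => perc r B fun E' => f (E ∪ E') := by
  unfold perc
  simp_rw [Finset.mul_sum]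
  rw [← Finset.sum_product']
  symm
  apply Finset.sum_nbij' (fun x => x.1 ∪ x.2) (fun E => (E ∩ A, E ∩ B))
  · rintro ⟨E, E'⟩ hE
    simp only [Finset.mem_product, Finset.mem_powerset] at hE ⊢
    exact Finset.union_subset_union hE.1 hE.2
  · intro E _
    simp only [Finset.mem_product, Finset.mem_powerset]
    exact ⟨Finset.inter_subset_right, Finset.inter_subset_right⟩
  · rintro ⟨E, E'⟩ hE
    simp only [Finset.mem_product, Finset.mem_powerset] at hE
    have h1 : E' ∩ A = ∅ := Finset.disjoint_iff_inter_eq_empty.mp (h.symm.mono_left hE.2)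
    have h2 : E ∩ B = ∅ := Finset.disjoint_iff_inter_eq_empty.mp (h.mono_left hE.1)
    simp only [Finset.union_inter_distrib_right, h1, h2, Finset.union_empty, Finset.empty_union,
      Finset.inter_eq_left.mpr hE.1, Finset.inter_eq_left.mpr hE.2]
  · intro E hE
    simp only [Finset.mem_powerset] at hE
    simp only [← Finset.inter_union_distrib_left, Finset.inter_eq_left.mpr hE]
  · rintro ⟨E, E'⟩ hE
    simp only [Finset.mem_product, Finset.mem_powerset] at hE
    have hd : Disjoint E E' := (h.mono_left hE.1).mono_right hE.2
    have c1 := Finset.card_le_card hE.1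
    have c2 := Finset.card_le_card hE.2
    simp only [Finset.card_union_of_disjoint hd, Finset.card_union_of_disjoint h]
    rw [show A.card + B.card - (E.card + E'.card) = (A.card - E.card) + (B.card - E'.card) by lia,
      pow_add, pow_add]
    ring

lemma perc_congr (h : ∀ E ⊆ B, f E = g E) : perc r B f = perc r B g :=
  Finset.sum_congr rfl fun E hE => by rw [h E (Finset.mem_powerset.mp hE)]

lemma perc_one : perc r B (fun _ => 1) = 1 := by
  unfold perc
  simp_rw [mul_one]
  rw [Finset.sum_pow_mul_eq_add_pow, sub_add_cancel, one_pow]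

lemma perc_mul_left (c : ℝ) : perc r B (fun E => c * f E) = c * perc r B f := by
  unfold perc
  rw [Finset.mul_sum]
  exact Finset.sum_congr rfl fun E _ => by ring

lemma perc_const (c : ℝ) : perc r B (fun _ => c) = c := by
  have := perc_mul_left (r := r) (B := B) (f := fun _ => 1) c
  rw [perc_one] at this
  simpa using this

lemma perc_add : perc r B (fun E => f E + g E) = perc r B f + perc r B g := by
  unfold perc
  rw [← Finset.sum_add_distrib]
  exact Finset.sum_congr rfl fun E _ => by ring

lemma perc_sum {ι : Type*} (s : Finset ι) (F : ι → Finset α → ℝ) :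
    perc r B (fun E => ∑ i ∈ s, F i E) = ∑ i ∈ s, perc r B (F i) := by
  unfold perc
  rw [Finset.sum_comm]
  exact Finset.sum_congr rfl fun E _ => by rw [Finset.mul_sum]

lemma perc_mono (h0 : 0 ≤ r) (h1 : r ≤ 1) (h : ∀ E ⊆ B, f E ≤ g E) : perc r B f ≤ perc r B g := by
  apply Finset.sum_le_sum
  intro E hE
  exact mul_le_mul_of_nonneg_left (h E (Finset.mem_powerset.mp hE))
    (mul_nonneg (pow_nonneg (by linarith) _) (pow_nonneg h0 _))

lemma perc_nonneg (h0 : 0 ≤ r) (h1 : r ≤ 1) (h : ∀ E ⊆ B, 0 ≤ f E) : 0 ≤ perc r B f := by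
  have := perc_mono (f := fun _ => 0) (g := f) h0 h1 h
  rwa [perc_const] at this

lemma perc_ite_empty [DecidableEq α] (c : ℝ) :
    perc r B (fun E => if E = ∅ then c else 0) = r ^ B.card * c := by
  unfold perc
  rw [Finset.sum_eq_single ∅]
  · simp
  · intro E _ hE
    simp [hE]
  · simp

end perc

/-! ### Clusters -/

section cluster
variable {n q : ℕ}

/-- The connected component of `v` in the graph with edge set `E`. -/
noncomputable def cluster (E : Finset (Fin n × Fin n)) (v : Fin n) : Finset (Fin n) :=
  Finset.univ.filter fun u => (graphOf E).Reachable v u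

/-- Monochromatic pairs with both ends in `A`. -/
noncomputable def pairsIn (σ : Conf n q) (A : Finset (Fin n)) : Finset (Fin n × Fin n) :=
  (monoPairs σ).filter fun e => e.1 ∈ A ∧ e.2 ∈ A

/-- The vertices of `A` with the spin of `v`. -/
noncomputable def spinClass (σ : Conf n q) (A : Finset (Fin n)) (v : Fin n) : Finset (Fin n) :=
  A.filter fun u => σ u = σ v

lemma mem_cluster {E : Finset (Fin n × Fin n)} {v u : Fin n} :
    u ∈ cluster E v ↔ (graphOf E).Reachable v u := by simp [cluster]

lemma self_mem_cluster (E : Finset (Fin n × Fin n)) (v : Fin n) : v ∈ cluster E v :=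
  mem_cluster.mpr (SimpleGraph.Reachable.refl v)

lemma card_cluster_pos (E : Finset (Fin n × Fin n)) (v : Fin n) : 0 < (cluster E v).card :=
  Finset.card_pos.mpr ⟨v, self_mem_cluster E v⟩

lemma graphOf_adj {E : Finset (Fin n × Fin n)} {u v : Fin n} :
    (graphOf E).Adj u v ↔ u ≠ v ∧ ((u, v) ∈ E ∨ (v, u) ∈ E) := by
  simp [graphOf]

lemma graphOf_mono {E E' : Finset (Fin n × Fin n)} (h : E ⊆ E') : graphOf E ≤ graphOf E' := by
  intro u v huv
  rw [graphOf_adj] at huv ⊢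
  exact ⟨huv.1, huv.2.imp (fun x => h x) fun x => h x⟩

lemma cluster_mono {E E' : Finset (Fin n × Fin n)} (h : E ⊆ E') (v : Fin n) :
    cluster E v ⊆ cluster E' v := fun _ hu =>
  mem_cluster.mpr ((mem_cluster.mp hu).mono (graphOf_mono h))

lemma cluster_eq_of_mem {E : Finset (Fin n × Fin n)} {u v : Fin n} (h : u ∈ cluster E v) :
    cluster E u = cluster E v := by
  have h' := mem_cluster.mp h
  ext w
  rw [mem_cluster, mem_cluster]
  exact ⟨fun x => h'.trans x, fun x => h'.symm.trans x⟩

lemma cluster_closed {E : Finset (Fin n × Fin n)} {v a b : Fin n} (ha : a ∈ cluster E v)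
    (hab : (graphOf E).Adj a b) : b ∈ cluster E v :=
  mem_cluster.mpr ((mem_cluster.mp ha).trans hab.reachable)

lemma cluster_subset_of_closed {E : Finset (Fin n × Fin n)} {v : Fin n} {S : Finset (Fin n)}
    (hv : v ∈ S) (h : ∀ a b, a ∈ S → (graphOf E).Adj a b → b ∈ S) : cluster E v ⊆ S := by
  intro u hu
  obtain ⟨p⟩ := mem_cluster.mp hu
  clear hu
  induction p with
  | nil => exact hv
  | cons hadj _ ih => exact ih (h _ _ hv hadj)

lemma cluster_subset_spinClass {σ : Conf n q} {A : Finset (Fin n)} {E : Finset (Fin n × Fin n)}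
    (hE : E ⊆ pairsIn σ A) {v : Fin n} (hv : v ∈ A) : cluster E v ⊆ spinClass σ A v := by
  apply cluster_subset_of_closed
  · simp [spinClass, hv]
  · intro a b ha hab
    rw [graphOf_adj] at hab
    simp only [spinClass, Finset.mem_filter] at ha ⊢
    rcases hab.2 with h | h
    · have := hE h
      simp only [pairsIn, monoPairs, Finset.mem_filter] at this
      exact ⟨this.2.2, this.1.2.2 ▸ ha.2⟩
    · have := hE h
      simp only [pairsIn, monoPairs, Finset.mem_filter] at this
      exact ⟨this.2.1, this.1.2.2.trans ha.2⟩

/-- Edges with an end outside `S` must avoid `S` altogether when `S` is a cluster. -/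
lemma cluster_union_eq_iff {E₁ E₂ : Finset (Fin n × Fin n)} {v : Fin n} {S : Finset (Fin n)}
    (hE : ∀ e ∈ E₂, e.1 ∉ S ∨ e.2 ∉ S) :
    cluster (E₁ ∪ E₂) v = S ↔ cluster E₁ v = S ∧ ∀ e ∈ E₂, e.1 ∉ S ∧ e.2 ∉ S := by
  have avoid : (∀ e ∈ E₂, e.1 ∉ S ∧ e.2 ∉ S) → ∀ a b, a ∈ S → (graphOf (E₁ ∪ E₂)).Adj a b →
      (graphOf E₁).Adj a b := by
    intro h a b ha hab
    rw [graphOf_adj] at hab ⊢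
    refine ⟨hab.1, ?_⟩
    rcases hab.2 with h' | h'
    · rcases Finset.mem_union.mp h' with h'' | h''
      · exact Or.inl h''
      · exact absurd ha (h _ h'').1
    · rcases Finset.mem_union.mp h' with h'' | h''
      · exact Or.inr h''
      · exact absurd ha (h _ h'').2
  constructor
  · intro h
    have hav : ∀ e ∈ E₂, e.1 ∉ S ∧ e.2 ∉ S := by
      intro e he
      by_cases hee : e.1 = e.2
      · have := hE e he
        rw [hee] at this ⊢
        tauto
      · have hadj : (graphOf (E₁ ∪ E₂)).Adj e.1 e.2 :=
          graphOf_adj.mpr ⟨hee, Or.inl (Finset.mem_union_right _ he)⟩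
        have h1 : e.1 ∈ S → e.2 ∈ S := fun h1 => by
          rw [← h] at h1 ⊢
          exact cluster_closed h1 hadj
        have h2 : e.2 ∈ S → e.1 ∈ S := fun h1 => by
          rw [← h] at h1 ⊢
          exact cluster_closed h1 hadj.symm
        have := hE e he
        tauto
    refine ⟨?_, hav⟩
    apply Finset.Subset.antisymm
    · rw [← h]
      exact cluster_mono Finset.subset_union_left v
    · nth_rewrite 1 [← h]
      apply cluster_subset_of_closed (self_mem_cluster _ _)
      intro a b ha hab
      have haS : a ∈ S := by
        rw [← h]
        exact cluster_mono Finset.subset_union_left v ha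
      exact cluster_closed ha (avoid hav a b haS hab)
  · rintro ⟨h, hav⟩
    apply Finset.Subset.antisymm
    · apply cluster_subset_of_closed (h ▸ self_mem_cluster _ _)
      intro a b ha hab
      have := avoid hav a b ha hab
      rw [← h] at ha ⊢
      exact cluster_closed ha this
    · rw [← h]
      exact cluster_mono Finset.subset_union_left v

/-- Exploring the cluster `S` of `v`: the edges of `B` not in `B₁` that meet `S` are closed, and
those that avoid `S` are independent of the exploration. -/
lemma perc_cluster_eq {r : ℝ} {B B₁ : Finset (Fin n × Fin n)} {v : Fin n} {S : Finset (Fin n)}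
    (hB : B₁ ⊆ B) (hS : ∀ e ∈ B \ B₁, e.1 ∉ S ∨ e.2 ∉ S) (h : Finset (Fin n × Fin n) → ℝ) :
    perc r B (fun E => if cluster E v = S then h E else 0) =
      perc r B₁ (fun E₁ => if cluster E₁ v = S then
        r ^ ((B \ B₁).filter fun e => e.1 ∈ S ∨ e.2 ∈ S).card *
          perc r ((B \ B₁).filter fun e => ¬ (e.1 ∈ S ∨ e.2 ∈ S))
            (fun E₃ => h (E₁ ∪ E₃)) else 0) := by
  set B₂ := (B \ B₁).filter fun e => e.1 ∈ S ∨ e.2 ∈ S with hB₂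
  set B₃ := (B \ B₁).filter fun e => ¬ (e.1 ∈ S ∨ e.2 ∈ S) with hB₃
  have hsplit : B = B₁ ∪ (B₂ ∪ B₃) := by
    rw [hB₂, hB₃, Finset.filter_union_filter_not_eq, Finset.union_sdiff_of_subset hB]
  have hd1 : Disjoint B₁ (B₂ ∪ B₃) := by
    rw [hB₂, hB₃, Finset.filter_union_filter_not_eq]
    exact Finset.disjoint_sdiff
  have hd2 : Disjoint B₂ B₃ := Finset.disjoint_filter_filter_not _ _ _
  nth_rewrite 1 [hsplit]
  rw [perc_union hd1]
  apply perc_congr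
  intro E₁ _
  rw [perc_union hd2]
  rw [perc_congr (g := fun E₂ => if E₂ = ∅ then
    (if cluster E₁ v = S then perc r B₃ (fun E₃ => h (E₁ ∪ E₃)) else 0) else 0)]
  · rw [perc_ite_empty]
    split_ifs <;> simp
  · intro E₂ hE₂
    have hiff : ∀ E₃ ⊆ B₃, cluster (E₁ ∪ (E₂ ∪ E₃)) v = S ↔ cluster E₁ v = S ∧ E₂ = ∅ := by
      intro E₃ hE₃
      have hsub : E₂ ∪ E₃ ⊆ B \ B₁ := Finset.union_subset
        (hE₂.trans (Finset.filter_subset _ _)) (hE₃.trans (Finset.filter_subset _ _))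
      rw [cluster_union_eq_iff fun e he => hS e (hsub he)]
      apply and_congr_right
      intro _
      constructor
      · intro hav
        rw [Finset.eq_empty_iff_forall_notMem]
        intro e he
        have h1 := hav e (Finset.mem_union_left _ he)
        have h2 := (Finset.mem_filter.mp (hE₂ he)).2
        tauto
      · rintro rfl e he
        rw [Finset.empty_union] at he
        have h2 := (Finset.mem_filter.mp (hE₃ he)).2
        tauto
    by_cases h2 : E₂ = ∅
    · rw [if_pos h2]
      by_cases h1 : cluster E₁ v = S
      · rw [if_pos h1]
        apply perc_congr
        intro E₃ hE₃
        rw [if_pos ((hiff E₃ hE₃).mpr ⟨h1, h2⟩), h2, Finset.empty_union]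
      · rw [if_neg h1]
        refine (perc_congr (g := fun _ => 0) ?_).trans (perc_const 0)
        intro E₃ hE₃
        rw [if_neg fun hc => h1 ((hiff E₃ hE₃).mp hc).1]
    · rw [if_neg h2]
      refine (perc_congr (g := fun _ => 0) ?_).trans (perc_const 0)
      intro E₃ hE₃
      rw [if_neg fun hc => h2 ((hiff E₃ hE₃).mp hc).2]

end cluster

section identities
variable {n q : ℕ}

lemma mem_pairsIn {σ : Conf n q} {A : Finset (Fin n)} {e : Fin n × Fin n} :
    e ∈ pairsIn σ A ↔ (e.1 < e.2 ∧ σ e.1 = σ e.2) ∧ e.1 ∈ A ∧ e.2 ∈ A := by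
  simp [pairsIn, monoPairs]

lemma pairsIn_mono (σ : Conf n q) {A B : Finset (Fin n)} (h : A ⊆ B) :
    pairsIn σ A ⊆ pairsIn σ B := by
  intro e he
  rw [mem_pairsIn] at he ⊢
  exact ⟨he.1, h he.2.1, h he.2.2⟩

lemma pairsIn_univ (σ : Conf n q) : pairsIn σ Finset.univ = monoPairs σ := by
  simp [pairsIn]

lemma perc_eq_sum_cluster {r : ℝ} {B : Finset (Fin n × Fin n)} (v : Fin n)
    (f : Finset (Fin n × Fin n) → ℝ) :
    perc r B f = ∑ S : Finset (Fin n), perc r B fun E => if cluster E v = S then f E else 0 := by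
  rw [← perc_sum]
  apply perc_congr
  intro E _
  rw [Finset.sum_ite_eq Finset.univ (cluster E v) fun _ => f E, if_pos (Finset.mem_univ _)]

/-- The number of monochromatic pairs joining two disjoint sets of vertices of equal spin. -/
lemma card_pairs_between {σ : Conf n q} {A D S : Finset (Fin n)} (hD : D ⊆ A) (hS : S ⊆ A \ D)
    (hc : ∀ a ∈ S, ∀ b ∈ D, σ a = σ b) :
    ((pairsIn σ A \ pairsIn σ (A \ D)).filter fun e => e.1 ∈ S ∨ e.2 ∈ S).card =
      D.card * S.card := by
  rw [mul_comm, ← Finset.card_product]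
  symm
  apply Finset.card_nbij (fun x : Fin n × Fin n => if x.1 < x.2 then x else (x.2, x.1))
  · rintro ⟨a, b⟩ hab
    obtain ⟨ha, hb⟩ := Finset.mem_product.mp hab
    simp only at ha hb
    have haA := Finset.mem_sdiff.mp (hS ha)
    have hne : a ≠ b := fun h => haA.2 (h ▸ hb)
    have hs := hc a ha b hb
    rw [Finset.mem_coe]
    show (if a < b then (a, b) else (b, a)) ∈ _
    split_ifs with hlt <;> rw [Finset.mem_filter, Finset.mem_sdiff, mem_pairsIn, mem_pairsIn]
    · exact ⟨⟨⟨⟨hlt, hs⟩, haA.1, hD hb⟩, fun h => (Finset.mem_sdiff.mp h.2.2).2 hb⟩, Or.inl ha⟩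
    · have hlt' : b < a := lt_of_le_of_ne (not_lt.mp hlt) hne.symm
      exact ⟨⟨⟨⟨hlt', hs.symm⟩, hD hb, haA.1⟩,
        fun h => (Finset.mem_sdiff.mp h.2.1).2 hb⟩, Or.inr ha⟩
  · rintro ⟨a, b⟩ hab ⟨a', b'⟩ hab' h
    obtain ⟨ha, hb⟩ := Finset.mem_product.mp hab
    obtain ⟨ha', hb'⟩ := Finset.mem_product.mp hab'
    have haA := Finset.mem_sdiff.mp (hS ha)
    have haA' := Finset.mem_sdiff.mp (hS ha')
    simp only at h ha hb ha' hb' haA haA'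
    split_ifs at h <;> simp only [Prod.mk.injEq] at h ⊢
    · exact h
    · exact absurd (h.1 ▸ hb') haA.2
    · exact absurd (h.2 ▸ hb') haA.2
    · exact ⟨h.2, h.1⟩
  · rintro ⟨a, b⟩ he
    simp only [Finset.coe_filter, Finset.mem_sdiff, mem_pairsIn, Set.mem_ofPred_eq] at he
    obtain ⟨⟨⟨⟨hlt, hs⟩, haA, hbA⟩, hnot⟩, hor⟩ := he
    have hnS : ∀ x ∈ S, x ∉ D := fun x hx => (Finset.mem_sdiff.mp (hS hx)).2
    by_cases haS : a ∈ S
    · have hbD : b ∈ D := by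
        by_contra hb
        exact hnot ⟨⟨hlt, hs⟩, ⟨haA, hnS a haS⟩, hbA, hb⟩
      exact ⟨(a, b), by simp [haS, hbD], by simp [hlt]⟩
    · have hbS : b ∈ S := by tauto
      have haD : a ∈ D := by
        by_contra ha
        exact hnot ⟨⟨hlt, hs⟩, ⟨haA, ha⟩, hbA, hnS b hbS⟩
      exact ⟨(b, a), by simp [haD, hbS], by simp [not_lt.mpr hlt.le]⟩

/-- Removing the vertices of `D` tilts the law of the cluster of `v` by an explicit factor. -/
lemma perc_disjoint_cluster {r R : ℝ} (hrR : r * R = 1) (σ : Conf n q) {A D : Finset (Fin n)}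
    {v : Fin n} (hv : v ∈ A) (hD : D ⊆ (spinClass σ A v).erase v) :
    perc r (pairsIn σ A) (fun E => if Disjoint (cluster E v) D then
      R ^ (D.card * (cluster E v).card) else 0) = 1 := by
  have hDA : D ⊆ A := hD.trans ((Finset.erase_subset _ _).trans (Finset.filter_subset _ _))
  have hvD : v ∉ D := fun h => by simpa using hD h
  have hvAD : v ∈ A \ D := Finset.mem_sdiff.mpr ⟨hv, hvD⟩
  rw [perc_eq_sum_cluster v]
  rw [← perc_one (r := r) (B := pairsIn σ (A \ D)), perc_eq_sum_cluster v (fun _ => 1)]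
  apply Finset.sum_congr rfl
  intro S _
  have hnone : ¬ (S ⊆ spinClass σ (A \ D) v) →
      perc r (pairsIn σ (A \ D)) (fun E => if cluster E v = S then (1 : ℝ) else 0) = 0 := by
    intro hS
    refine (perc_congr (g := fun _ => 0) fun E hE => ?_).trans (perc_const 0)
    rw [if_neg]
    rintro rfl
    exact hS (cluster_subset_spinClass hE hvAD)
  by_cases hSD : Disjoint S D
  · rw [perc_congr (g := fun E => if cluster E v = S then R ^ (D.card * S.card) else 0)]
    · rw [perc_cluster_eq (B₁ := pairsIn σ (A \ D)) (pairsIn_mono σ Finset.sdiff_subset)]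
      · by_cases hS : S ⊆ spinClass σ (A \ D) v
        · rw [card_pairs_between hDA (hS.trans (Finset.filter_subset _ _))]
          · apply perc_congr
            intro E _
            rw [perc_const, ← mul_pow, hrR, one_pow]
          · intro a ha b hb
            have h1 := (Finset.mem_filter.mp (hS ha)).2
            have h2 := (Finset.mem_filter.mp (Finset.mem_of_mem_erase (hD hb))).2
            rw [h1, h2]
        · rw [hnone hS]
          refine (perc_congr (g := fun _ => 0) fun E hE => ?_).trans (perc_const 0)
          rw [if_neg]
          rintro rfl
          exact hS (cluster_subset_spinClass hE hvAD)
      · intro e he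
        rw [Finset.mem_sdiff, mem_pairsIn, mem_pairsIn] at he
        by_contra hc
        push Not at hc
        exact he.2 ⟨he.1.1,
          Finset.mem_sdiff.mpr ⟨he.1.2.1, Finset.disjoint_left.mp hSD hc.1⟩,
          Finset.mem_sdiff.mpr ⟨he.1.2.2, Finset.disjoint_left.mp hSD hc.2⟩⟩
    · intro E _
      split_ifs with h1 h2
      · rw [h1]
      · exact absurd (h1 ▸ hSD) h2
      · rfl
  · rw [hnone]
    · refine (perc_congr (g := fun _ => 0) fun E _ => ?_).trans (perc_const 0)
      split_ifs with h1 h2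
      · exact absurd (h1 ▸ h2) hSD
      · rfl
      · rfl
    · intro hS
      apply hSD
      rw [Finset.disjoint_left]
      intro a ha
      exact (Finset.mem_sdiff.mp (Finset.mem_filter.mp (hS ha)).1).2

/-- Exact factorial moment identities for the size of a cluster in a class of `N` vertices. -/
lemma perc_choose_cluster {r R : ℝ} (hrR : r * R = 1) (σ : Conf n q) {A : Finset (Fin n)}
    {v : Fin n} (hv : v ∈ A) (m : ℕ) :
    perc r (pairsIn σ A) (fun E =>
      (((spinClass σ A v).card - (cluster E v).card).choose m : ℝ) * R ^ (m * (cluster E v).card)) =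
      (((spinClass σ A v).card - 1).choose m : ℝ) := by
  have hvc : v ∈ spinClass σ A v := by simp [spinClass, hv]
  have h := perc_sum (r := r) (B := pairsIn σ A) (((spinClass σ A v).erase v).powersetCard m)
    fun D E => if Disjoint (cluster E v) D then R ^ (D.card * (cluster E v).card) else 0
  rw [Finset.sum_congr rfl (g := fun _ => (1 : ℝ))] at h
  · rw [Finset.sum_const, Finset.card_powersetCard, Finset.card_erase_of_mem hvc,
      nsmul_eq_mul, mul_one] at h
    rw [← h]
    apply perc_congr
    intro E hE
    have hsub := cluster_subset_spinClass hE hv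
    rw [← Finset.sum_filter]
    have hfil : (((spinClass σ A v).erase v).powersetCard m).filter
        (fun D => Disjoint (cluster E v) D) = (spinClass σ A v \ cluster E v).powersetCard m := by
      ext D
      simp only [Finset.mem_filter, Finset.mem_powersetCard]
      constructor
      · rintro ⟨⟨h1, h2⟩, h3⟩
        refine ⟨fun x hx => Finset.mem_sdiff.mpr
          ⟨Finset.mem_of_mem_erase (h1 hx), Finset.disjoint_right.mp h3 hx⟩, h2⟩
      · rintro ⟨h1, h2⟩
        refine ⟨⟨fun x hx => Finset.mem_erase.mpr ⟨?_, (Finset.mem_sdiff.mp (h1 hx)).1⟩, h2⟩,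
          Finset.disjoint_right.mpr fun x hx => (Finset.mem_sdiff.mp (h1 hx)).2⟩
        rintro rfl
        exact (Finset.mem_sdiff.mp (h1 hx)).2 (self_mem_cluster _ _)
    rw [hfil, Finset.sum_congr rfl (g := fun _ => R ^ (m * (cluster E v).card))]
    · rw [Finset.sum_const, Finset.card_powersetCard, Finset.card_sdiff_of_subset hsub,
        nsmul_eq_mul]
    · intro D hD
      rw [(Finset.mem_powersetCard.mp hD).2]
  · intro D hD
    exact perc_disjoint_cluster hrR σ hv (Finset.mem_powersetCard.mp hD).1

/-- After revealing the cluster of `v`, the rest of the graph is a fresh percolation. -/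
lemma perc_two_clusters {r : ℝ} (h0 : 0 ≤ r) (h1 : r ≤ 1) (σ : Conf n q) {A : Finset (Fin n)}
    {v w : Fin n} {c : ℝ} (hc : 0 ≤ c) (P : Finset (Fin n) → Prop)
    (Q : Finset (Fin n) → Finset (Fin n) → Prop)
    (hPQ : ∀ S ⊆ spinClass σ A v, P S → w ∈ A \ S →
      perc r (pairsIn σ (A \ S)) (fun E => if Q S (cluster E w) then 1 else 0) ≤ c)
    (hv : v ∈ A) (hw : w ∈ A) :
    perc r (pairsIn σ A) (fun E => if P (cluster E v) ∧ w ∉ cluster E v ∧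
      Q (cluster E v) (cluster E w) then 1 else 0) ≤ c := by
  rw [perc_eq_sum_cluster v]
  have hbound : ∀ S : Finset (Fin n), (perc r (pairsIn σ A) fun E => if cluster E v = S then
      (if P (cluster E v) ∧ w ∉ cluster E v ∧ Q (cluster E v) (cluster E w) then (1 : ℝ) else 0)
        else 0) ≤
      c * perc r (pairsIn σ A) fun E => if cluster E v = S then 1 else 0 := by
    intro S
    by_cases hS : S ⊆ spinClass σ A v ∧ P S ∧ w ∉ S
    · obtain ⟨hS, hP, hwS⟩ := hS
      have hSA : S ⊆ A := hS.trans (Finset.filter_subset _ _)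
      have hout : ∀ e ∈ pairsIn σ A \ pairsIn σ S, e.1 ∉ S ∨ e.2 ∉ S := by
        intro e he
        rw [Finset.mem_sdiff, mem_pairsIn, mem_pairsIn] at he
        tauto
      have hrest : ((pairsIn σ A \ pairsIn σ S).filter fun e => ¬ (e.1 ∈ S ∨ e.2 ∈ S)) =
          pairsIn σ (A \ S) := by
        ext e
        simp only [Finset.mem_filter, Finset.mem_sdiff, mem_pairsIn]
        tauto
      rw [perc_congr (g := fun E => if cluster E v = S then
        (if Q S (cluster E w) then (1 : ℝ) else 0) else 0)]
      · rw [perc_cluster_eq (pairsIn_mono σ hSA) hout, perc_cluster_eq (pairsIn_mono σ hSA) hout,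
          ← perc_mul_left]
        apply perc_mono h0 h1
        intro E₁ hE₁
        split_ifs with hcl
        · rw [perc_const, hrest, mul_left_comm]
          apply mul_le_mul_of_nonneg_left _ (pow_nonneg h0 _)
          rw [mul_one]
          refine (perc_congr fun E₃ hE₃ => ?_).trans_le
            (hPQ S hS hP (Finset.mem_sdiff.mpr ⟨hw, hwS⟩))
          have hcw : cluster (E₃ ∪ E₁) w = cluster E₃ w := by
            have hsub := cluster_subset_spinClass hE₃ (Finset.mem_sdiff.mpr ⟨hw, hwS⟩)
            have hav : ∀ e ∈ E₁, e.1 ∉ cluster E₃ w ∧ e.2 ∉ cluster E₃ w := by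
              intro e he
              have := mem_pairsIn.mp (hE₁ he)
              constructor
              · intro hx
                exact (Finset.mem_sdiff.mp (Finset.mem_filter.mp (hsub hx)).1).2 this.2.1
              · intro hx
                exact (Finset.mem_sdiff.mp (Finset.mem_filter.mp (hsub hx)).1).2 this.2.2
            rw [cluster_union_eq_iff fun e he => Or.inl (hav e he).1]
            exact ⟨rfl, hav⟩
          rw [Finset.union_comm, hcw]
        · simp
      · intro E _
        by_cases hcl : cluster E v = S
        · simp [hcl, hP, hwS]
        · simp [hcl]
    · refine (perc_congr (g := fun _ => 0) fun E hE => ?_).trans_le ?_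
      · split_ifs with hcl h
        · exact absurd ⟨hcl ▸ cluster_subset_spinClass hE hv, hcl ▸ h.1, hcl ▸ h.2.1⟩ hS
        · rfl
        · rfl
      · rw [perc_const]
        apply mul_nonneg hc
        apply perc_nonneg h0 h1
        intro E _
        split_ifs <;> norm_num
  calc _ ≤ ∑ S : Finset (Fin n), c * perc r (pairsIn σ A) fun E =>
        if cluster E v = S then 1 else 0 := Finset.sum_le_sum fun S _ => hbound S
    _ = c := by
      rw [← Finset.mul_sum, ← perc_eq_sum_cluster v (fun _ => 1), perc_one, mul_one]

end identities

/-- Probability of the event `P` under percolation on `B`. -/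
noncomputable def percProb {α : Type*} (r : ℝ) (B : Finset α) (P : Finset α → Prop) : ℝ :=
  perc r B fun E => if P E then 1 else 0

section percProb
variable {α : Type*} {r : ℝ} {B : Finset α} {P Q : Finset α → Prop}

lemma percProb_mono (h0 : 0 ≤ r) (h1 : r ≤ 1) (h : ∀ E ⊆ B, P E → Q E) :
    percProb r B P ≤ percProb r B Q := by
  apply perc_mono h0 h1
  intro E hE
  split_ifs with hP hQ
  · exact le_rfl
  · exact absurd (h E hE hP) hQ
  · exact zero_le_one
  · exact le_rfl

lemma percProb_nonneg (h0 : 0 ≤ r) (h1 : r ≤ 1) : 0 ≤ percProb r B P := by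
  apply perc_nonneg h0 h1
  intro E _
  split_ifs <;> norm_num

lemma percProb_or_le (h0 : 0 ≤ r) (h1 : r ≤ 1) :
    percProb r B (fun E => P E ∨ Q E) ≤ percProb r B P + percProb r B Q := by
  unfold percProb
  rw [← perc_add]
  apply perc_mono h0 h1
  intro E _
  by_cases hP : P E <;> by_cases hQ : Q E <;> simp [hP, hQ]

lemma percProb_exists_le {ι : Type*} [Fintype ι] (h0 : 0 ≤ r) (h1 : r ≤ 1)
    (P : ι → Finset α → Prop) :
    percProb r B (fun E => ∃ i, P i E) ≤ ∑ i, percProb r B (P i) := by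
  unfold percProb
  rw [← perc_sum]
  apply perc_mono h0 h1
  intro E _
  split_ifs with h
  · obtain ⟨i, hi⟩ := h
    have := Finset.single_le_sum (f := fun i => if P i E then (1 : ℝ) else 0)
      (fun j _ => by split_ifs <;> norm_num) (Finset.mem_univ i)
    simpa [hi] using this
  · exact Finset.sum_nonneg fun j _ => by split_ifs <;> norm_num

lemma percProb_not : percProb r B (fun E => ¬ P E) = 1 - percProb r B P := by
  have : percProb r B (fun E => ¬ P E) + percProb r B P = 1 := by
    unfold percProb
    rw [← perc_add]
    refine (perc_congr (g := fun _ => 1) fun E _ => ?_).trans perc_one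
    by_cases h : P E <;> simp [h]
  linarith

lemma percProb_le_one (h0 : 0 ≤ r) (h1 : r ≤ 1) : percProb r B P ≤ 1 := by
  have := percProb_not (r := r) (B := B) (P := P)
  have := percProb_nonneg (B := B) (P := fun E => ¬ P E) h0 h1
  linarith

/-- Markov's inequality. -/
lemma mul_percProb_le (h0 : 0 ≤ r) (h1 : r ≤ 1) {f : Finset α → ℝ} {a : ℝ}
    (hf : ∀ E ⊆ B, 0 ≤ f E) (h : ∀ E ⊆ B, P E → a ≤ f E) : a * percProb r B P ≤ perc r B f := by
  unfold percProb
  rw [← perc_mul_left]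
  apply perc_mono h0 h1
  intro E hE
  split_ifs with hP
  · simpa using h E hE hP
  · simpa using hf E hE

end percProb

section giant
variable {n q : ℕ}

lemma card_cluster_le (E : Finset (Fin n × Fin n)) (v : Fin n) : (cluster E v).card ≤ n := by
  simpa using Finset.card_le_univ (cluster E v)

/-- A cluster of linear size is unlikely not to be of the size of the giant. -/
lemma percProb_atypical_le {β η c : ℝ} (hβ : 0 < β) (hc : 0 < c)
    (hdef : ∀ x k, 0 ≤ x → x ≤ 1 → k ≤ x → η ≤ k → η ≤ |k - giantMass β x| →
      c ≤ |(x - k) * Real.exp (β * k) - x|)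
    (hn : 1 ≤ n) (σ : Conf n q) {A : Finset (Fin n)} {v : Fin n} (hv : v ∈ A) :
    percProb (Real.exp (-(β / n))) (pairsIn σ A) (fun E => η ≤ ((cluster E v).card : ℝ) / n ∧
      η ≤ |((cluster E v).card : ℝ) / n - giantMass β (((spinClass σ A v).card : ℝ) / n)|) ≤
      3 * Real.exp (2 * β) / c ^ 2 / n := by
  have hn0 : (0 : ℝ) < n := by exact_mod_cast hn
  have hn1 : (1 : ℝ) ≤ n := by exact_mod_cast hn
  set r := Real.exp (-(β / n)) with hr
  set R := Real.exp (β / n) with hR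
  set N := (spinClass σ A v).card with hN
  have hrR : r * R = 1 := by rw [hr, hR, ← Real.exp_add]; simp
  have h0 : 0 ≤ r := (Real.exp_pos _).le
  have h1 : r ≤ 1 := Real.exp_le_one_iff.mpr (by have := div_pos hβ hn0; linarith)
  have hR1 : 1 ≤ R := Real.one_le_exp (div_pos hβ hn0).le
  have hkN : ∀ E ⊆ pairsIn σ A, (cluster E v).card ≤ N := fun E hE =>
    Finset.card_le_card (cluster_subset_spinClass hE hv)
  have hNn : N ≤ n := by simpa using Finset.card_le_univ (spinClass σ A v)
  have hN1 : 1 ≤ N := Finset.card_pos.mpr ⟨v, by simp [spinClass, hv]⟩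
  have hNr : (N : ℝ) ≤ n := by exact_mod_cast hNn
  have e1 := perc_choose_cluster hrR σ hv 1
  have e2 := perc_choose_cluster hrR σ hv 2
  rw [← hN, Nat.cast_choose_two, Nat.cast_sub hN1] at e2
  rw [← hN, Nat.choose_one_right, Nat.cast_sub hN1] at e1
  have hexpand : perc r (pairsIn σ A) (fun E =>
      (((N : ℝ) - (cluster E v).card) * R ^ (cluster E v).card - N) ^ 2) ≤
      3 * Real.exp (2 * β) * n := by
    have hrw : perc r (pairsIn σ A) (fun E =>
        (((N : ℝ) - (cluster E v).card) * R ^ (cluster E v).card - N) ^ 2) ≤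
        perc r (pairsIn σ A) (fun E =>
        (2 * (((N - (cluster E v).card).choose 2 : ℝ) * R ^ (2 * (cluster E v).card)) +
          -(2 * N) * (((N - (cluster E v).card).choose 1 : ℝ) * R ^ (1 * (cluster E v).card))) +
          ((N : ℝ) ^ 2 + n * Real.exp (2 * β))) := by
      apply perc_mono h0 h1
      intro E hE
      have hk := hkN E hE
      have hRk : R ^ (2 * (cluster E v).card) ≤ Real.exp (2 * β) := by
        rw [hR, ← Real.exp_nat_mul]
        apply Real.exp_le_exp.mpr
        have : ((cluster E v).card : ℝ) ≤ n := by exact_mod_cast card_cluster_le E v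
        push_cast
        rw [mul_assoc]
        have h3 : ((cluster E v).card : ℝ) * (β / n) ≤ n * (β / n) :=
          mul_le_mul_of_nonneg_right this (div_pos hβ hn0).le
        rw [mul_div_cancel₀ _ hn0.ne'] at h3
        linarith
      rw [Nat.cast_choose_two, Nat.choose_one_right, Nat.cast_sub hk, one_mul]
      have h4 : ((N : ℝ) - (cluster E v).card) * R ^ (2 * (cluster E v).card) ≤
          n * Real.exp (2 * β) := by
        apply mul_le_mul _ hRk (by positivity) hn0.le
        have : (0 : ℝ) ≤ (cluster E v).card := Nat.cast_nonneg _
        linarith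
      have h5 : R ^ (2 * (cluster E v).card) = (R ^ (cluster E v).card) ^ 2 := by
        rw [mul_comm, pow_mul]
      rw [h5] at h4 ⊢
      nlinarith
    refine hrw.trans ?_
    rw [perc_add, perc_add, perc_mul_left, perc_mul_left, perc_const, e1, e2]
    have : 1 ≤ Real.exp (2 * β) := Real.one_le_exp (by linarith)
    have hN1' : (1 : ℝ) ≤ N := by exact_mod_cast hN1
    push_cast
    nlinarith
  have hmark := mul_percProb_le (r := r) (B := pairsIn σ A)
    (P := fun E => η ≤ ((cluster E v).card : ℝ) / n ∧
      η ≤ |((cluster E v).card : ℝ) / n - giantMass β ((N : ℝ) / n)|)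
    (f := fun E => (((N : ℝ) - (cluster E v).card) * R ^ (cluster E v).card - N) ^ 2)
    (a := c ^ 2 * n ^ 2) h0 h1 (fun E _ => sq_nonneg _) (by
      rintro E hE ⟨ha, hb⟩
      have hk := hkN E hE
      have hk' : ((cluster E v).card : ℝ) ≤ N := by exact_mod_cast hk
      have hd := hdef ((N : ℝ) / n) _ (by positivity) (by rw [div_le_one hn0]; exact hNr)
        (by gcongr) ha hb
      have hpow : R ^ (cluster E v).card = Real.exp (β * ((cluster E v).card / n)) := by
        rw [hR, ← Real.exp_nat_mul]
        congr 1
        ring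
      have heq : ((N : ℝ) - (cluster E v).card) * R ^ (cluster E v).card - N =
          n * (((N : ℝ) / n - (cluster E v).card / n) *
            Real.exp (β * ((cluster E v).card / n)) - N / n) := by
        rw [hpow]
        field_simp
      rw [heq, mul_pow, mul_comm, ← sq_abs (_ - _)]
      gcongr)
  rw [div_div, le_div_iff₀ (by positivity)]
  have h6 : (percProb r (pairsIn σ A) (fun E => η ≤ ((cluster E v).card : ℝ) / n ∧
      η ≤ |((cluster E v).card : ℝ) / n - giantMass β ((N : ℝ) / n)|) * (c ^ 2 * n)) * n ≤
      (3 * Real.exp (2 * β)) * n := by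
    calc _ = c ^ 2 * n ^ 2 * percProb r (pairsIn σ A) (fun E => η ≤ ((cluster E v).card : ℝ) / n ∧
      η ≤ |((cluster E v).card : ℝ) / n - giantMass β ((N : ℝ) / n)|) := by ring
      _ ≤ _ := hmark.trans hexpand
  exact le_of_mul_le_mul_right h6 hn0

/-- A cluster is small with probability not much more than in the limiting branching process. -/
lemma percProb_small_le {β η : ℝ} (hβ : 0 < β) (hη : 0 ≤ η) (hn : 1 ≤ n) (σ : Conf n q)
    {A : Finset (Fin n)} {v : Fin n} (hv : v ∈ A) {m : ℕ}
    (hm : (m : ℝ) / n ≤ giantMass β (((spinClass σ A v).card : ℝ) / n - η)) :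
    percProb (Real.exp (-(β / n))) (pairsIn σ A) (fun E => ((cluster E v).card : ℝ) / n ≤ η) ≤
      Real.exp (-(β * (m / n))) := by
  have hn0 : (0 : ℝ) < n := by exact_mod_cast hn
  set r := Real.exp (-(β / n)) with hr
  set R := Real.exp (β / n) with hR
  set N := (spinClass σ A v).card with hN
  have hrR : r * R = 1 := by rw [hr, hR, ← Real.exp_add]; simp
  have h0 : 0 ≤ r := (Real.exp_pos _).le
  have h1 : r ≤ 1 := Real.exp_le_one_iff.mpr (by have := div_pos hβ hn0; linarith)
  rcases Nat.eq_zero_or_pos m with rfl | hmpos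
  · simpa using percProb_le_one h0 h1
  have hm0 : (0 : ℝ) < m := by exact_mod_cast hmpos
  have hsup : 1 < β * ((N : ℝ) / n - η) := by
    by_contra hle
    rw [giantMass_eq_zero (not_lt.mp hle)] at hm
    have : 0 < (m : ℝ) / n := by positivity
    linarith
  have hpos : 0 < (N : ℝ) / n - η := by
    by_contra hle
    have := mul_nonpos_of_nonneg_of_nonpos hβ.le (not_lt.mp hle)
    linarith
  have hRm : R ^ m = Real.exp (β * (m / n)) := by
    rw [hR, ← Real.exp_nat_mul]
    congr 1
    ring
  have hind : ∀ j : ℕ, ((j + 1 : ℕ) : ℝ) / n ≤ η →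
      ((N - 1).choose m : ℝ) ≤ ((N - 1 - j).choose m : ℝ) * R ^ (m * j) := by
    intro j
    induction j with
    | zero => intro _; simp
    | succ j ih =>
      intro hj
      have hj' : ((j + 1 : ℕ) : ℝ) / n ≤ η := by
        refine le_trans ?_ hj
        gcongr
        exact Nat.le_succ _
      refine (ih hj').trans ?_
      have hlt : ((j + 1 : ℕ) : ℝ) < N := by
        have : ((j + 1 : ℕ) : ℝ) / n < N / n := by linarith
        exact (div_lt_div_iff_of_pos_right hn0).mp this
      have hlt' : j + 1 < N := by exact_mod_cast hlt
      obtain ⟨M, hM⟩ : ∃ M, N - 1 - j = M + 1 := ⟨N - 1 - j - 1, by lia⟩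
      have hM' : N - 1 - (j + 1) = M := by lia
      have hMr : ((M + 1 : ℕ) : ℝ) / n = N / n - ((j + 1 : ℕ) : ℝ) / n := by
        rw [← sub_div, ← Nat.cast_sub hlt'.le]
        congr 2
        lia
      rw [hM, hM']
      have hge : (m : ℝ) / n ≤ giantMass β (((M + 1 : ℕ) : ℝ) / n) := by
        refine hm.trans (giantMass_monotone hβ ?_)
        rw [hMr]
        linarith
      have hkey := le_sub_mul_exp_of_le_giantMass hβ (by positivity) hge
      have hmM : m ≤ M + 1 := by
        have h3 : (m : ℝ) / n ≤ ((M + 1 : ℕ) : ℝ) / n :=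
          hge.trans (giantMass_le_self hβ (by positivity))
        exact_mod_cast (div_le_div_iff_of_pos_right hn0).mp h3
      have hkey' : ((M + 1 : ℕ) : ℝ) ≤ ((M + 1 - m : ℕ) : ℝ) * R ^ m := by
        rw [hRm, Nat.cast_sub hmM]
        rw [← sub_div, div_mul_eq_mul_div] at hkey
        exact (div_le_div_iff_of_pos_right hn0).mp hkey
      have hch : (M.choose m : ℝ) * ((M + 1 : ℕ) : ℝ) =
          ((M + 1).choose m : ℝ) * ((M + 1 - m : ℕ) : ℝ) := by
        exact_mod_cast Nat.choose_mul_succ_eq M m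
      have hM0 : (0 : ℝ) < ((M + 1 : ℕ) : ℝ) := by positivity
      rw [show m * (j + 1) = m * j + m by ring, pow_add]
      apply le_of_mul_le_mul_right _ hM0
      calc ((M + 1).choose m : ℝ) * R ^ (m * j) * ((M + 1 : ℕ) : ℝ)
          ≤ ((M + 1).choose m : ℝ) * R ^ (m * j) * (((M + 1 - m : ℕ) : ℝ) * R ^ m) := by
            gcongr
        _ = (((M + 1).choose m : ℝ) * ((M + 1 - m : ℕ) : ℝ)) * (R ^ (m * j) * R ^ m) := by ring
        _ = _ := by rw [← hch]; ring
  have hchpos : (0 : ℝ) < ((N - 1).choose m : ℝ) := by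
    have hg : giantMass β ((N : ℝ) / n - η) < N / n - η := (giantMass_spec hβ hsup).2.1
    have h3 : (m : ℝ) / n < N / n := by linarith
    have h4 : m < N := by exact_mod_cast (div_lt_div_iff_of_pos_right hn0).mp h3
    exact_mod_cast Nat.choose_pos (by lia)
  have hmark := mul_percProb_le (r := r) (B := pairsIn σ A)
    (P := fun E => ((cluster E v).card : ℝ) / n ≤ η)
    (f := fun E => ((N - (cluster E v).card).choose m : ℝ) * R ^ (m * (cluster E v).card))
    (a := R ^ m * ((N - 1).choose m : ℝ)) h0 h1 (fun E _ => by positivity) (by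
      intro E _ hE
      obtain ⟨j, hj⟩ : ∃ j, (cluster E v).card = j + 1 :=
        ⟨(cluster E v).card - 1, by have := card_cluster_pos E v; lia⟩
      rw [hj] at hE ⊢
      rw [show m * (j + 1) = m * j + m by ring, pow_add, ← mul_assoc, mul_comm (R ^ m),
        show N - (j + 1) = N - 1 - j by lia]
      gcongr
      exact hind j hE)
  rw [perc_choose_cluster hrR σ hv m] at hmark
  rw [Real.exp_neg, ← hRm, ← one_div, le_div_iff₀ (by positivity)]
  apply le_of_mul_le_mul_right _ hchpos
  calc _ = R ^ m * ((N - 1).choose m : ℝ) * percProb r (pairsIn σ A)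
        (fun E => ((cluster E v).card : ℝ) / n ≤ η) := by ring
    _ ≤ _ := hmark
    _ = _ := (one_mul _).symm

end giant

section classes
variable {n q : ℕ}

/-- Vertices of spin `i`. -/
noncomputable def spinSet (σ : Conf n q) (i : Fin q) : Finset (Fin n) :=
  Finset.univ.filter fun v => σ v = i

/-- The percolation configuration `E` behaves as expected on spin class `i`: up to an error `η`
there is one cluster of the predicted size and all the others are negligible. -/
def GoodClass (β η : ℝ) (σ : Conf n q) (i : Fin q) (E : Finset (Fin n × Fin n)) : Prop :=
  ∃ L : Finset (Fin n), (L = ∅ ∨ ∃ v, L = cluster E v) ∧ L ⊆ spinSet σ i ∧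
    |(L.card : ℝ) / n - giantMass β (cntFrac σ i)| ≤ η ∧
    ∑ v ∈ spinSet σ i \ L, ((cluster E v).card : ℝ) ≤ η * n ^ 2 ∧
    (β * cntFrac σ i ≤ 1 → L = ∅)

/-- The cluster of `v` has linear size but not the size of the giant of spin class `i`. -/
def Atypical (β η : ℝ) (σ : Conf n q) (i : Fin q) (v : Fin n) (E : Finset (Fin n × Fin n)) : Prop :=
  η ≤ ((cluster E v).card : ℝ) / n ∧
    η ≤ |((cluster E v).card : ℝ) / n - giantMass β (cntFrac σ i)|

lemma mem_spinSet {σ : Conf n q} {i : Fin q} {v : Fin n} : v ∈ spinSet σ i ↔ σ v = i := by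
  simp [spinSet]

lemma card_spinSet_div (σ : Conf n q) (i : Fin q) :
    ((spinSet σ i).card : ℝ) / n = cntFrac σ i := rfl

lemma spinClass_univ {σ : Conf n q} {i : Fin q} {v : Fin n} (hv : v ∈ spinSet σ i) :
    spinClass σ Finset.univ v = spinSet σ i := by
  rw [mem_spinSet] at hv
  rw [spinClass, spinSet, hv]

lemma card_spinSet_le (σ : Conf n q) (i : Fin q) : ((spinSet σ i).card : ℝ) ≤ n := by
  have := Finset.card_le_univ (spinSet σ i)
  rw [Fintype.card_fin] at this
  exact_mod_cast this

lemma cluster_subset_spinSet {σ : Conf n q} {i : Fin q} {v : Fin n} (hv : v ∈ spinSet σ i)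
    {E : Finset (Fin n × Fin n)} (hE : E ⊆ monoPairs σ) : cluster E v ⊆ spinSet σ i := by
  rw [← spinClass_univ hv]
  exact cluster_subset_spinClass (by rwa [pairsIn_univ]) (Finset.mem_univ v)

lemma card_cluster_real_le (E : Finset (Fin n × Fin n)) (v : Fin n) :
    ((cluster E v).card : ℝ) ≤ n := by exact_mod_cast card_cluster_le E v

lemma percProb_not_goodClass_of_small {β η C r : ℝ} (h0 : 0 ≤ r) (h1 : r ≤ 1) (hη : 0 < η)
    (hC : 0 ≤ C) (hn : 1 ≤ n) (σ : Conf n q) (i : Fin q)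
    (hg0 : 0 ≤ giantMass β (cntFrac σ i)) (hg : giantMass β (cntFrac σ i) ≤ η / 4)
    (hat : ∀ v ∈ spinSet σ i, percProb r (monoPairs σ) (Atypical β (η / 4) σ i v) ≤ C / n) :
    percProb r (monoPairs σ) (fun E => ¬ GoodClass β η σ i E) ≤ 2 * C / η / n := by
  have hn0 : (0 : ℝ) < n := by exact_mod_cast hn
  have hmark := mul_percProb_le (r := r) (B := monoPairs σ)
    (P := fun E => ¬ GoodClass β η σ i E) (a := η * n / 2)
    (f := fun E => ∑ v ∈ spinSet σ i, if Atypical β (η / 4) σ i v E then (1 : ℝ) else 0) h0 h1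
    (fun E _ => Finset.sum_nonneg fun v _ => by split_ifs <;> norm_num) (by
      intro E _ hbad
      by_contra hlt
      rw [not_le] at hlt
      refine hbad ⟨∅, Or.inl rfl, Finset.empty_subset _, ?_, ?_, fun _ => rfl⟩
      · rw [abs_le]
        simp only [Finset.card_empty, Nat.cast_zero, zero_div]
        constructor <;> linarith
      · rw [Finset.sdiff_empty]
        calc ∑ v ∈ spinSet σ i, ((cluster E v).card : ℝ)
            ≤ ∑ v ∈ spinSet σ i, (η / 2 * n +
                n * if Atypical β (η / 4) σ i v E then (1 : ℝ) else 0) := by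
              apply Finset.sum_le_sum
              intro v _
              have hle := card_cluster_real_le E v
              split_ifs with ha
              · have : 0 < η / 2 * n := by positivity
                linarith
              · rw [Atypical, not_and_or, not_le, not_le] at ha
                have : ((cluster E v).card : ℝ) / n ≤ η / 2 := by
                  rcases ha with ha | ha
                  · linarith
                  · have := (abs_lt.mp ha).2
                    linarith
                rw [div_le_iff₀ hn0] at this
                linarith
          _ ≤ n * (η / 2 * n) + n * (η * n / 2) := by
              rw [Finset.sum_add_distrib, Finset.sum_const, nsmul_eq_mul, ← Finset.mul_sum]
              have := card_spinSet_le σ i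
              gcongr
          _ = η * n ^ 2 := by ring)
  have hE : perc r (monoPairs σ)
      (fun E => ∑ v ∈ spinSet σ i, if Atypical β (η / 4) σ i v E then (1 : ℝ) else 0) ≤ C := by
    rw [perc_sum]
    calc _ ≤ ∑ v ∈ spinSet σ i, C / n := Finset.sum_le_sum hat
      _ = (spinSet σ i).card * (C / n) := by rw [Finset.sum_const, nsmul_eq_mul]
      _ ≤ n * (C / n) := by
        have := card_spinSet_le σ i
        gcongr
      _ = C := mul_div_cancel₀ _ hn0.ne'
  rw [div_div, le_div_iff₀ (by positivity)]
  linarith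

/-- Number of vertices of spin class `i` with an atypical cluster. -/
noncomputable def atypicalCount (β η : ℝ) (σ : Conf n q) (i : Fin q)
    (E : Finset (Fin n × Fin n)) : ℝ :=
  ∑ v ∈ spinSet σ i, if Atypical β η σ i v E then (1 : ℝ) else 0

/-- The cluster of `v` looks like the giant and `w` lies in a different large cluster. -/
def Rival (β η : ℝ) (σ : Conf n q) (i : Fin q) (v w : Fin n) (E : Finset (Fin n × Fin n)) : Prop :=
  |((cluster E v).card : ℝ) / n - giantMass β (cntFrac σ i)| < η ∧ w ∉ cluster E v ∧
    3 * η ≤ ((cluster E w).card : ℝ) / n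

/-- Number of rival pairs in spin class `i`. -/
noncomputable def rivalCount (β η : ℝ) (σ : Conf n q) (i : Fin q)
    (E : Finset (Fin n × Fin n)) : ℝ :=
  ∑ v ∈ spinSet σ i, ∑ w ∈ spinSet σ i, if Rival β η σ i v w E then (1 : ℝ) else 0

/-- Number of vertices of spin class `i` in a small cluster. -/
noncomputable def smallCount (η : ℝ) (σ : Conf n q) (i : Fin q)
    (E : Finset (Fin n × Fin n)) : ℝ :=
  ∑ v ∈ spinSet σ i, if ((cluster E v).card : ℝ) / n ≤ 3 * η then (1 : ℝ) else 0

/-- Some cluster of spin class `i` looks like the giant. -/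
def HasGiant (β η : ℝ) (σ : Conf n q) (i : Fin q) (E : Finset (Fin n × Fin n)) : Prop :=
  ∃ v ∈ spinSet σ i, |((cluster E v).card : ℝ) / n - giantMass β (cntFrac σ i)| < η

lemma smallCount_of_not_hasGiant {β η : ℝ} (hη : 0 < η) {σ : Conf n q} {i : Fin q}
    {E : Finset (Fin n × Fin n)} (h : ¬ HasGiant β η σ i E) :
    (spinSet σ i).card - atypicalCount β η σ i E ≤ smallCount η σ i E := by
  have : ((spinSet σ i).card : ℝ) = ∑ v ∈ spinSet σ i, (1 : ℝ) := by simp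
  rw [this, atypicalCount, smallCount, ← Finset.sum_sub_distrib]
  apply Finset.sum_le_sum
  intro v hv
  split_ifs with h1 h2 h2
  · norm_num
  · norm_num
  · norm_num
  · exfalso
    rw [not_le] at h2
    exact h1 ⟨by linarith, not_lt.mp fun hlt => h ⟨v, hv, hlt⟩⟩

lemma rival_card_le {β η : ℝ} (hn : 1 ≤ n) {σ : Conf n q} {i : Fin q} (hη : 0 < η)
    (hg : 2 * η ≤ giantMass β (cntFrac σ i))
    {E : Finset (Fin n × Fin n)} (hE : E ⊆ monoPairs σ) {v₀ : Fin n} (hv : v₀ ∈ spinSet σ i)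
    (hv₀ : |((cluster E v₀).card : ℝ) / n - giantMass β (cntFrac σ i)| < η)
    (hr : rivalCount β η σ i E ≤ η ^ 2 * n ^ 2) :
    ∑ w ∈ spinSet σ i \ cluster E v₀,
      (if 3 * η ≤ ((cluster E w).card : ℝ) / n then (1 : ℝ) else 0) ≤ η * n := by
  have hn0 : (0 : ℝ) < n := by exact_mod_cast hn
  set b := ∑ w ∈ spinSet σ i \ cluster E v₀,
      (if 3 * η ≤ ((cluster E w).card : ℝ) / n then (1 : ℝ) else 0) with hb
  have hb0 : 0 ≤ b := Finset.sum_nonneg fun w _ => by split_ifs <;> norm_num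
  have hL : η * n ≤ (cluster E v₀).card := by
    rw [← le_div_iff₀ hn0]
    have := (abs_lt.mp hv₀).1
    linarith
  have h1 : (cluster E v₀).card * b ≤ rivalCount β η σ i E := by
    calc (cluster E v₀).card * b = ∑ v ∈ cluster E v₀, b := by
          rw [Finset.sum_const, nsmul_eq_mul]
      _ ≤ ∑ v ∈ cluster E v₀, ∑ w ∈ spinSet σ i, if Rival β η σ i v w E then (1 : ℝ) else 0 := by
          apply Finset.sum_le_sum
          intro v hv'
          have hcl := cluster_eq_of_mem hv'
          calc b = ∑ w ∈ spinSet σ i \ cluster E v₀,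
                if Rival β η σ i v w E then (1 : ℝ) else 0 := by
                rw [hb]
                apply Finset.sum_congr rfl
                intro w hw
                simp only [Rival, hcl, hv₀, (Finset.mem_sdiff.mp hw).2, not_false_eq_true, true_and]
            _ ≤ _ := Finset.sum_le_sum_of_subset_of_nonneg Finset.sdiff_subset
                fun w _ _ => by split_ifs <;> norm_num
      _ ≤ _ := Finset.sum_le_sum_of_subset_of_nonneg (cluster_subset_spinSet hv hE)
          fun v _ _ => Finset.sum_nonneg fun w _ => by split_ifs <;> norm_num
  have h2 : (η * n) * b ≤ (η * n) * (η * n) :=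
    (mul_le_mul_of_nonneg_right hL hb0).trans (h1.trans (hr.trans_eq (by ring)))
  exact le_of_mul_le_mul_left h2 (by positivity)

lemma smallCount_of_hasGiant {β η : ℝ} (hn : 1 ≤ n) {σ : Conf n q} {i : Fin q} (hη : 0 < η)
    (hg : 2 * η ≤ giantMass β (cntFrac σ i))
    {E : Finset (Fin n × Fin n)} (hE : E ⊆ monoPairs σ) (h : HasGiant β η σ i E)
    (hr : rivalCount β η σ i E ≤ η ^ 2 * n ^ 2) :
    (spinSet σ i).card - giantMass β (cntFrac σ i) * n - 2 * η * n ≤ smallCount η σ i E := by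
  have hn0 : (0 : ℝ) < n := by exact_mod_cast hn
  obtain ⟨v₀, hv, hv₀⟩ := h
  have hb := rival_card_le hn hη hg hE hv hv₀ hr
  have hsub := cluster_subset_spinSet hv hE
  have hcard : ∑ w ∈ spinSet σ i \ cluster E v₀, (1 : ℝ) =
      (spinSet σ i).card - (cluster E v₀).card := by
    rw [Finset.sum_const, nsmul_eq_mul, mul_one, Finset.card_sdiff_of_subset hsub,
      Nat.cast_sub (Finset.card_le_card hsub)]
  have hs : ∑ w ∈ spinSet σ i \ cluster E v₀, ((1 : ℝ) -
      (if 3 * η ≤ ((cluster E w).card : ℝ) / n then (1 : ℝ) else 0)) ≤ smallCount η σ i E := by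
    calc _ ≤ ∑ w ∈ spinSet σ i \ cluster E v₀,
          (if ((cluster E w).card : ℝ) / n ≤ 3 * η then (1 : ℝ) else 0) := by
          apply Finset.sum_le_sum
          intro w _
          split_ifs with h1 h2 h2
          · norm_num
          · norm_num
          · norm_num
          · exact absurd (le_of_not_ge h1) h2
      _ ≤ _ := Finset.sum_le_sum_of_subset_of_nonneg Finset.sdiff_subset
          fun w _ _ => by split_ifs <;> norm_num
  rw [Finset.sum_sub_distrib, hcard] at hs
  have := (abs_lt.mp hv₀).2
  have h3 : ((cluster E v₀).card : ℝ) ≤ (giantMass β (cntFrac σ i) + η) * n := by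
    rw [← div_le_iff₀ hn0]
    linarith
  linarith

lemma goodClass_of_hasGiant {β η ζ : ℝ} (hn : 1 ≤ n) {σ : Conf n q} {i : Fin q} (hη : 0 < η)
    (hg : 2 * η ≤ giantMass β (cntFrac σ i)) (hζ : 4 * η ≤ ζ)
    {E : Finset (Fin n × Fin n)} (hE : E ⊆ monoPairs σ) (h : HasGiant β η σ i E)
    (hr : rivalCount β η σ i E ≤ η ^ 2 * n ^ 2) : GoodClass β ζ σ i E := by
  have hn0 : (0 : ℝ) < n := by exact_mod_cast hn
  obtain ⟨v₀, hv, hv₀⟩ := h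
  have hb := rival_card_le hn hη hg hE hv hv₀ hr
  have hsub := cluster_subset_spinSet hv hE
  refine ⟨cluster E v₀, Or.inr ⟨v₀, rfl⟩, hsub, by linarith, ?_, fun hsubcrit => ?_⟩
  · calc ∑ v ∈ spinSet σ i \ cluster E v₀, ((cluster E v).card : ℝ)
        ≤ ∑ v ∈ spinSet σ i \ cluster E v₀, (3 * η * n +
            n * if 3 * η ≤ ((cluster E v).card : ℝ) / n then (1 : ℝ) else 0) := by
          apply Finset.sum_le_sum
          intro v _
          have hle := card_cluster_real_le E v
          split_ifs with ha
          · have : 0 < 3 * η * n := by positivity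
            linarith
          · rw [not_le, div_lt_iff₀ hn0] at ha
            linarith
      _ ≤ n * (3 * η * n) + n * (η * n) := by
          rw [Finset.sum_add_distrib, Finset.sum_const, nsmul_eq_mul, ← Finset.mul_sum]
          have h1 := card_spinSet_le σ i
          have h2 : ((spinSet σ i \ cluster E v₀).card : ℝ) ≤ (spinSet σ i).card := by
            exact_mod_cast Finset.card_le_card Finset.sdiff_subset
          have h3 := h2.trans h1
          gcongr
      _ = (4 * η) * n ^ 2 := by ring
      _ ≤ _ := by gcongr
  · rw [giantMass_eq_zero hsubcrit] at hg
    linarith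

end classes

section giants
variable {n q : ℕ}

lemma edge_prob_bounds {β : ℝ} (hβ : 0 < β) (n : ℕ) :
    0 ≤ Real.exp (-(β / n)) ∧ Real.exp (-(β / n)) ≤ 1 := by
  refine ⟨(Real.exp_pos _).le, Real.exp_le_one_iff.mpr ?_⟩
  have : 0 ≤ β / n := div_nonneg hβ.le (Nat.cast_nonneg n)
  linarith

lemma percProb_not_goodClass_of_large {β η ζ C : ℝ} (hβ : 0 < β) (hη : 0 < η)
    (hn : 1 ≤ n) (σ : Conf n q) (i : Fin q) (hζ : 4 * η ≤ ζ)
    (hg : 2 * η ≤ giantMass β (cntFrac σ i))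
    (hat : ∀ (A : Finset (Fin n)), ∀ v ∈ A, percProb (Real.exp (-(β / n))) (pairsIn σ A)
      (fun E => η ≤ ((cluster E v).card : ℝ) / n ∧
      η ≤ |((cluster E v).card : ℝ) / n - giantMass β (((spinClass σ A v).card : ℝ) / n)|) ≤
      C / n) (hC : 0 ≤ C) :
    percProb (Real.exp (-(β / n))) (monoPairs σ) (fun E => ¬ GoodClass β ζ σ i E) ≤
      (β * (6 * η + 1 / n) + 2 * η + (C / η + C / η ^ 2) / n) / giantMass β (cntFrac σ i) +
        (C / η + C / η ^ 2) / n := by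
  have hn0 : (0 : ℝ) < n := by exact_mod_cast hn
  obtain ⟨h0, h1⟩ := edge_prob_bounds hβ n
  set r := Real.exp (-(β / n)) with hr
  set x := cntFrac σ i with hx
  set g := giantMass β x with hgdef
  set B := monoPairs σ with hB
  have hN : ((spinSet σ i).card : ℝ) = x * n := by
    rw [hx, ← card_spinSet_div, div_mul_cancel₀ _ hn0.ne']
  have hNn := card_spinSet_le σ i
  have hg0 : 0 < g := by linarith
  have hsup : 1 < β * x := by
    by_contra hle
    rw [hgdef, giantMass_eq_zero (not_lt.mp hle)] at hg0
    exact lt_irrefl _ hg0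
  have hgx : g < x := (giantMass_spec hβ hsup).2.1
  have hx1 : x ≤ 1 := by
    have : x * n ≤ 1 * n := by rw [← hN, one_mul]; exact hNn
    exact le_of_mul_le_mul_right this hn0
  have hpairs : pairsIn σ Finset.univ = B := pairsIn_univ σ
  have hat' : ∀ v ∈ spinSet σ i, percProb r B (Atypical β η σ i v) ≤ C / n := by
    intro v hv
    have := hat Finset.univ v (Finset.mem_univ v)
    rw [hpairs, spinClass_univ hv] at this
    exact this
  have hriv : ∀ v ∈ spinSet σ i, ∀ w ∈ spinSet σ i,
      percProb r B (Rival β η σ i v w) ≤ C / n := by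
    intro v hv w hw
    rw [← hpairs]
    have key := fun h => perc_two_clusters h0 h1 σ (v := v) (w := w) (c := C / n) (by positivity)
      (fun S => |((S.card : ℝ)) / n - g| < η) (fun _ S' => 3 * η ≤ (S'.card : ℝ) / n) h
      (Finset.mem_univ v) (Finset.mem_univ w)
    refine (le_of_eq (perc_congr fun E _ => ?_)).trans (key ?_)
    · exact if_congr Iff.rfl rfl rfl
    intro S hS hP hwS
    refine (percProb_mono h0 h1 fun E _ hE => ?_).trans (hat (Finset.univ \ S) w hwS)
    have hcl : (spinClass σ (Finset.univ \ S) w).card = (spinSet σ i).card - S.card := by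
      rw [spinClass_univ hv] at hS
      rw [← Finset.card_sdiff_of_subset hS]
      congr 1
      ext u
      rw [mem_spinSet] at hw
      simp only [spinClass, Finset.mem_filter, Finset.mem_sdiff, Finset.mem_univ, true_and,
        mem_spinSet, hw, and_comm]
    rw [spinClass_univ hv] at hS
    have hsm : giantMass β (((spinClass σ (Finset.univ \ S) w).card : ℝ) / n) ≤ 2 * η := by
      rw [hcl, Nat.cast_sub (Finset.card_le_card hS), hN, sub_div, mul_div_cancel_right₀ _ hn0.ne']
      have hl := abs_giantMass_sub_le hβ (x - (S.card : ℝ) / n) (x - g)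
      rw [giantMass_eq_zero (mul_sub_giantMass_le_one hβ), sub_zero] at hl
      rw [show x - (S.card : ℝ) / n - (x - g) = -((S.card : ℝ) / n - g) by ring, abs_neg] at hl
      have := (abs_le.mp hl).2
      linarith
    refine ⟨by linarith, le_trans ?_ (le_abs_self _)⟩
    linarith
  set fail : Finset (Fin n × Fin n) → Prop := fun E =>
    η * n ≤ atypicalCount β η σ i E ∨ η ^ 2 * n ^ 2 ≤ rivalCount β η σ i E with hfail
  have hfailP : percProb r B fail ≤ (C / η + C / η ^ 2) / n := by
    refine (percProb_or_le h0 h1).trans ?_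
    rw [add_div]
    apply add_le_add
    · have hm := mul_percProb_le (r := r) (B := B) (P := fun E => η * n ≤ atypicalCount β η σ i E)
        (f := atypicalCount β η σ i) (a := η * n) h0 h1
        (fun E _ => Finset.sum_nonneg fun v _ => by split_ifs <;> norm_num) (fun E _ h => h)
      have he : perc r B (atypicalCount β η σ i) ≤ C := by
        unfold atypicalCount
        rw [perc_sum]
        calc _ ≤ ∑ v ∈ spinSet σ i, C / n := Finset.sum_le_sum hat'
          _ = (spinSet σ i).card * (C / n) := by rw [Finset.sum_const, nsmul_eq_mul]
          _ ≤ n * (C / n) := by gcongr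
          _ = C := mul_div_cancel₀ _ hn0.ne'
      rw [div_div, le_div_iff₀ (by positivity)]
      linarith
    · have hm := mul_percProb_le (r := r) (B := B)
        (P := fun E => η ^ 2 * n ^ 2 ≤ rivalCount β η σ i E)
        (f := rivalCount β η σ i) (a := η ^ 2 * n ^ 2) h0 h1
        (fun E _ => Finset.sum_nonneg fun v _ => Finset.sum_nonneg fun w _ => by
          split_ifs <;> norm_num) (fun E _ h => h)
      have he : perc r B (rivalCount β η σ i) ≤ C * n := by
        unfold rivalCount
        simp_rw [perc_sum]
        calc _ ≤ ∑ v ∈ spinSet σ i, ∑ w ∈ spinSet σ i, C / n :=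
              Finset.sum_le_sum fun v hv => Finset.sum_le_sum fun w hw => hriv v hv w hw
          _ = (spinSet σ i).card * ((spinSet σ i).card * (C / n)) := by
              simp only [Finset.sum_const, nsmul_eq_mul]
          _ ≤ n * (n * (C / n)) := by gcongr
          _ = C * n := by field_simp
      rw [div_div, le_div_iff₀ (by positivity)]
      have h3 : (percProb r B (fun E => η ^ 2 * n ^ 2 ≤ rivalCount β η σ i E) * (η ^ 2 * n)) * n ≤
          C * n := by
        linarith
      exact le_of_mul_le_mul_right h3 hn0
  set m := ⌊giantMass β (x - 3 * η) * n⌋₊ with hm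
  have hm1 : (m : ℝ) / n ≤ giantMass β (x - 3 * η) := by
    rw [div_le_iff₀ hn0]
    exact Nat.floor_le (mul_nonneg (giantMass_nonneg hβ _) hn0.le)
  have hm2 : g - 6 * η - 1 / n ≤ (m : ℝ) / n := by
    have h3 := Nat.lt_floor_add_one (giantMass β (x - 3 * η) * n)
    rw [← hm, ← lt_div_iff₀ hn0, add_div] at h3
    have h4 := (abs_le.mp (abs_giantMass_sub_le hβ (x - 3 * η) x)).1
    rw [show x - 3 * η - x = -(3 * η) by ring, abs_neg, abs_of_pos (by positivity)] at h4
    linarith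
  have hm3 : (m : ℝ) / n ≤ g := hm1.trans (giantMass_monotone hβ (by linarith))
  have hsmall : perc r B (smallCount η σ i) ≤ (x - g + β * (6 * η + 1 / n)) * n := by
    have hone : ∀ v ∈ spinSet σ i, percProb r B (fun E => ((cluster E v).card : ℝ) / n ≤ 3 * η) ≤
        Real.exp (-(β * (m / n))) := by
      intro v hv
      rw [← hpairs]
      apply percProb_small_le hβ (by positivity) hn σ (Finset.mem_univ v)
      rw [spinClass_univ hv]
      exact hm1
    have hexp : Real.exp (-(β * (m / n))) ≤ Real.exp (-(β * g)) + β * (6 * η + 1 / n) := by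
      have hb : Real.exp (-(β * (m / n))) * (1 - β * (g - m / n)) ≤ Real.exp (-(β * g)) := by
        rw [show -(β * g) = -(β * (m / n)) + -(β * (g - m / n)) by ring, Real.exp_add]
        gcongr
        have := Real.add_one_le_exp (-(β * (g - m / n)))
        linarith
      have hle1 : Real.exp (-(β * (m / n))) ≤ 1 := Real.exp_le_one_iff.mpr (by
        have : 0 ≤ β * ((m : ℝ) / n) := by positivity
        linarith)
      have hd0 : 0 ≤ β * (g - m / n) := mul_nonneg hβ.le (by linarith)
      have h5 : Real.exp (-(β * (m / n))) * (β * (g - m / n)) ≤ β * (g - m / n) :=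
        mul_le_of_le_one_left hd0 hle1
      have h6 : β * (g - m / n) ≤ β * (6 * η + 1 / n) := by
        gcongr
        linarith
      linarith
    have hroot := exp_neg_mul_giantMass hβ hsup
    rw [← hgdef] at hroot
    unfold smallCount
    rw [perc_sum]
    calc _ ≤ ∑ v ∈ spinSet σ i, Real.exp (-(β * (m / n))) := Finset.sum_le_sum hone
      _ = x * n * Real.exp (-(β * (m / n))) := by rw [Finset.sum_const, nsmul_eq_mul, hN]
      _ ≤ x * n * (Real.exp (-(β * g)) + β * (6 * η + 1 / n)) := by
          apply mul_le_mul_of_nonneg_left hexp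
          rw [← hN]
          positivity
      _ = (x * Real.exp (-(β * g)) + x * (β * (6 * η + 1 / n))) * n := by ring
      _ ≤ _ := by
          have : x * (β * (6 * η + 1 / n)) ≤ β * (6 * η + 1 / n) :=
            mul_le_of_le_one_left (by positivity) hx1
          gcongr
          linarith
  have hpoint : ((x - g - 2 * η) * n) + (g * n * percProb r B (fun E => ¬ HasGiant β η σ i E) +
      -n * percProb r B fail) ≤ perc r B (smallCount η σ i) := by
    unfold percProb
    rw [← perc_mul_left, ← perc_mul_left, ← perc_add,
      ← perc_const (r := r) (B := B) ((x - g - 2 * η) * n), ← perc_add]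
    apply perc_mono h0 h1
    intro E hE
    have hs0 : 0 ≤ smallCount η σ i E :=
      Finset.sum_nonneg fun v _ => by split_ifs <;> norm_num
    by_cases hf : fail E
    · rw [if_pos hf]
      have h3 : x * n ≤ n := by rw [← hN]; exact hNn
      have h4 : 0 < g * n := by positivity
      have h5 : 0 < η * n := by positivity
      split_ifs <;> linarith
    · rw [if_neg hf]
      rw [hfail] at hf
      push Not at hf
      by_cases hH : HasGiant β η σ i E
      · have := smallCount_of_hasGiant hn hη hg hE hH hf.2.le
        rw [hN] at this
        simp only [hH, not_true_eq_false, if_false]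
        linarith
      · have := smallCount_of_not_hasGiant hη hH
        rw [hN] at this
        simp only [hH, not_false_eq_true, if_true]
        have h5 : 0 < η * n := by positivity
        linarith [hf.1]
  have hbad : percProb r B (fun E => ¬ GoodClass β ζ σ i E) ≤
      percProb r B (fun E => ¬ HasGiant β η σ i E) + percProb r B fail := by
    refine (percProb_mono h0 h1 fun E hE h => ?_).trans (percProb_or_le h0 h1)
    by_contra hc
    push Not at hc
    obtain ⟨hc1, hc2⟩ := hc
    rw [hfail] at hc2
    push Not at hc2
    exact h (goodClass_of_hasGiant hn hη hg hζ hE hc1 hc2.2.le)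
  refine hbad.trans (add_le_add ?_ hfailP)
  rw [le_div_iff₀ hg0]
  have h7 : (percProb r B (fun E => ¬ HasGiant β η σ i E) * g) * n ≤
      (β * (6 * η + 1 / n) + 2 * η + (C / η + C / η ^ 2) / n) * n := by
    have := mul_le_mul_of_nonneg_right hfailP hn0.le
    linarith
  exact le_of_mul_le_mul_right h7 hn0

/-- With high probability, every spin class has the predicted cluster structure. -/
lemma exists_forall_percProb_not_goodClass_le {β η : ℝ} (hβ : 0 < β) (hη : 0 < η) (q : ℕ) :
    ∃ N₀ : ℕ, ∀ n : ℕ, N₀ ≤ n → 1 ≤ n → ∀ (σ : Conf n q) (i : Fin q),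
      percProb (Real.exp (-(β / n))) (monoPairs σ) (fun E => ¬ GoodClass β η σ i E) ≤ η := by
  set ξ := min (η / 8) (η ^ 2 / (16 * (6 * β + 2))) with hξ
  have hξ0 : 0 < ξ := by positivity
  have hξ1 : ξ ≤ η / 8 := min_le_left _ _
  have hξ2 : (6 * β + 2) * ξ ≤ η ^ 2 / 16 := by
    have : ξ ≤ η ^ 2 / (16 * (6 * β + 2)) := min_le_right _ _
    rw [le_div_iff₀ (by positivity)] at this
    linarith
  obtain ⟨c, hc, hdef⟩ := exists_le_abs_root_defect hβ hξ0
  obtain ⟨c', hc', hdef'⟩ := exists_le_abs_root_defect hβ (show 0 < η / 4 by positivity)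
  set C := 3 * Real.exp (2 * β) / c ^ 2 with hCdef
  set C' := 3 * Real.exp (2 * β) / c' ^ 2 with hCdef'
  have hC : 0 < C := by positivity
  have hC' : 0 < C' := by positivity
  set D := C / ξ + C / ξ ^ 2 with hD
  have hD0 : 0 < D := by positivity
  set K := (2 * C' / η) / η + (4 / η * (β + D) + D) / (η / 2) with hK
  refine ⟨⌈K⌉₊, fun n hn hn1 σ i => ?_⟩
  have hn0 : (0 : ℝ) < n := by exact_mod_cast hn1
  have hKn : K ≤ n := (Nat.le_ceil K).trans (by exact_mod_cast hn)
  obtain ⟨h0, h1⟩ := edge_prob_bounds hβ n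
  have hK1 : (2 * C' / η) / η ≤ n := le_trans (le_add_of_nonneg_right (by positivity)) hKn
  have hK2 : (4 / η * (β + D) + D) / (η / 2) ≤ n :=
    le_trans (le_add_of_nonneg_left (by positivity)) hKn
  rcases le_or_gt (giantMass β (cntFrac σ i)) (η / 4) with hg | hg
  · refine (percProb_not_goodClass_of_small h0 h1 hη hC'.le hn1 σ i (giantMass_nonneg hβ _) hg
      fun v hv => ?_).trans ?_
    · have := percProb_atypical_le hβ hc' hdef' hn1 σ (Finset.mem_univ v)
      rw [pairsIn_univ, spinClass_univ hv] at this
      exact this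
    · rw [div_le_iff₀ hη] at hK1
      rw [div_le_iff₀ hn0]
      linarith
  · refine (percProb_not_goodClass_of_large hβ hξ0 hn1 σ i (ζ := η) (by linarith) (by linarith)
      (fun A v hv => percProb_atypical_le hβ hc hdef hn1 σ hv) hC.le).trans ?_
    rw [← hCdef, ← hD]
    have hb : (β * (6 * ξ + 1 / n) + 2 * ξ + D / n) / giantMass β (cntFrac σ i) ≤
        (β * (6 * ξ + 1 / n) + 2 * ξ + D / n) / (η / 4) := by
      apply div_le_div_of_nonneg_left _ (by positivity) hg.le
      positivity
    have he : (β * (6 * ξ + 1 / n) + 2 * ξ + D / n) / (η / 4) =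
        4 / η * ((6 * β + 2) * ξ) + (4 / η * (β + D)) / n := by
      field_simp
      ring
    have hf : 4 / η * ((6 * β + 2) * ξ) ≤ 4 / η * (η ^ 2 / 16) := by gcongr
    have hf' : 4 / η * (η ^ 2 / 16) = η / 4 := by
      field_simp
      ring
    have hh : (4 / η * (β + D)) / n + D / n ≤ η / 2 := by
      rw [← add_div, div_le_iff₀ hn0]
      rw [div_le_iff₀ (by positivity)] at hK2
      linarith
    linarith

end giants

section colouring
variable {n q : ℕ}

/-- Expectation of `f` over a uniformly random colouring of the clusters of `E`. -/
noncomputable def colExp (E : Finset (Fin n × Fin n)) (f : Conf n q → ℝ) : ℝ :=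
  ∑ τ : Conf n q, (if ∀ u v : Fin n, (graphOf E).Reachable u v → τ u = τ v then
    ((q : ℝ))⁻¹ ^ numComps E else 0) * f τ

lemma sum_swStep_mul (β : ℝ) (σ : Conf n q) (f : Conf n q → ℝ) :
    ∑ τ, swStep n q β σ τ * f τ =
      perc (Real.exp (-(β / n))) (monoPairs σ) fun E => colExp E f := by
  unfold swStep perc colExp
  simp_rw [Finset.sum_mul, Finset.mul_sum]
  rw [Finset.sum_comm]
  exact Finset.sum_congr rfl fun E _ => Finset.sum_congr rfl fun τ _ => by rw [mul_assoc]

lemma swStep_nonneg {β : ℝ} (hβ : 0 < β) (σ τ : Conf n q) : 0 ≤ swStep n q β σ τ := by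
  obtain ⟨h0, h1⟩ := edge_prob_bounds hβ n
  apply perc_nonneg h0 h1
  intro E _
  split_ifs <;> positivity

lemma colExp_mono {E : Finset (Fin n × Fin n)} {f g : Conf n q → ℝ}
    (h : ∀ τ : Conf n q, (∀ u v : Fin n, (graphOf E).Reachable u v → τ u = τ v) → f τ ≤ g τ) :
    colExp E f ≤ colExp E g := by
  apply Finset.sum_le_sum
  intro τ _
  split_ifs with hτ
  · exact mul_le_mul_of_nonneg_left (h τ hτ) (by positivity)
  · simp

lemma colExp_congr {E : Finset (Fin n × Fin n)} {f g : Conf n q → ℝ}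
    (h : ∀ τ, f τ = g τ) : colExp E f = colExp E g := by
  rw [funext h]

lemma colExp_add (E : Finset (Fin n × Fin n)) (f g : Conf n q → ℝ) :
    colExp E (fun τ => f τ + g τ) = colExp E f + colExp E g := by
  unfold colExp
  rw [← Finset.sum_add_distrib]
  exact Finset.sum_congr rfl fun τ _ => by ring

lemma colExp_mul_left (E : Finset (Fin n × Fin n)) (c : ℝ) (f : Conf n q → ℝ) :
    colExp E (fun τ => c * f τ) = c * colExp E f := by
  unfold colExp
  rw [Finset.mul_sum]
  exact Finset.sum_congr rfl fun τ _ => by ring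

lemma colExp_sum {ι : Type*} (E : Finset (Fin n × Fin n)) (s : Finset ι)
    (f : ι → Conf n q → ℝ) :
    colExp E (fun τ => ∑ i ∈ s, f i τ) = ∑ i ∈ s, colExp E (f i) := by
  unfold colExp
  rw [Finset.sum_comm]
  exact Finset.sum_congr rfl fun τ _ => by rw [Finset.mul_sum]

lemma sum_uniform_pi {ι : Type*} [Fintype ι] (hq : 0 < q) (s : Finset ι) (j : Fin q) :
    ((q : ℝ))⁻¹ ^ Fintype.card ι *
      ∑ c : ι → Fin q, (if ∀ a ∈ s, c a = j then (1 : ℝ) else 0) = ((q : ℝ))⁻¹ ^ s.card := by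
  have hq0 : (q : ℝ) ≠ 0 := by exact_mod_cast hq.ne'
  have h := Finset.prod_univ_sum (fun _ : ι => (Finset.univ : Finset (Fin q)))
    (fun a x => ((q : ℝ))⁻¹ * if a ∈ s → x = j then (1 : ℝ) else 0)
  rw [Fintype.piFinset_univ] at h
  rw [Finset.mul_sum]
  have h1 : ∀ c : ι → Fin q, ((q : ℝ))⁻¹ ^ Fintype.card ι *
      (if ∀ a ∈ s, c a = j then (1 : ℝ) else 0) =
      ∏ a, ((q : ℝ))⁻¹ * if a ∈ s → c a = j then (1 : ℝ) else 0 := by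
    intro c
    rw [Finset.prod_mul_distrib, Finset.prod_const, Finset.card_univ, Finset.prod_boole]
    simp
  rw [Finset.sum_congr rfl fun c _ => h1 c, ← h]
  have h2 : ∀ a : ι, ∑ x : Fin q, ((q : ℝ))⁻¹ * (if a ∈ s → x = j then (1 : ℝ) else 0) =
      if a ∈ s then ((q : ℝ))⁻¹ else 1 := by
    intro a
    by_cases ha : a ∈ s
    · simp [ha]
    · simp [ha, hq0]
  rw [Finset.prod_congr rfl fun a _ => h2 a, Finset.prod_ite_mem, Finset.univ_inter,
    Finset.prod_const]

lemma colExp_eq_sum_components (E : Finset (Fin n × Fin n)) (f : Conf n q → ℝ) :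
    colExp E f = ((q : ℝ))⁻¹ ^ Fintype.card (graphOf E).ConnectedComponent *
      ∑ c : (graphOf E).ConnectedComponent → Fin q,
        f fun v => c ((graphOf E).connectedComponentMk v) := by
  have hnum : numComps E = Fintype.card (graphOf E).ConnectedComponent :=
    Nat.card_eq_fintype_card
  unfold colExp
  simp_rw [ite_mul, zero_mul]
  rw [← Finset.sum_filter, ← Finset.mul_sum, hnum]
  congr 1
  symm
  apply Finset.sum_nbij fun c v => c ((graphOf E).connectedComponentMk v)
  · intro c _
    simp only [Finset.mem_filter, Finset.mem_univ, true_and]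
    intro u v huv
    rw [SimpleGraph.ConnectedComponent.eq.mpr huv]
  · intro c _ c' _ h
    funext a
    induction a using SimpleGraph.ConnectedComponent.ind with
    | h v => exact congrFun h v
  · intro τ hτ
    have hτ' : ∀ u v : Fin n, (graphOf E).Reachable u v → τ u = τ v := by simpa using hτ
    exact ⟨fun a => Quot.lift τ hτ' a, by simp, rfl⟩
  · intro c _
    rfl

/-- The probability that the clusters of the vertices in `s` all receive colour `j`. -/
lemma colExp_forall_eq (hq : 0 < q) (E : Finset (Fin n × Fin n)) (s : Finset (Fin n))
    (j : Fin q) :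
    colExp E (fun τ => if ∀ v ∈ s, τ v = j then (1 : ℝ) else 0) =
      ((q : ℝ))⁻¹ ^ (s.image fun v => (graphOf E).connectedComponentMk v).card := by
  rw [colExp_eq_sum_components, ← sum_uniform_pi hq _ j]
  congr 1
  apply Finset.sum_congr rfl
  intro c _
  apply if_congr _ rfl rfl
  simp

lemma colExp_one (hq : 0 < q) (E : Finset (Fin n × Fin n)) :
    colExp E (fun _ : Conf n q => 1) = 1 := by
  simpa using colExp_forall_eq hq E ∅ ⟨0, hq⟩

lemma colExp_const (hq : 0 < q) (E : Finset (Fin n × Fin n)) (c : ℝ) :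
    colExp E (fun _ : Conf n q => c) = c := by
  have := colExp_mul_left E c (fun _ : Conf n q => 1)
  rw [colExp_one hq] at this
  simpa using this

lemma colExp_eq_colour (hq : 0 < q) (E : Finset (Fin n × Fin n)) (v : Fin n) (j : Fin q) :
    colExp E (fun τ => if τ v = j then (1 : ℝ) else 0) = ((q : ℝ))⁻¹ := by
  simpa using colExp_forall_eq hq E {v} j

lemma colExp_eq_colour_pair_le (hq : 0 < q) (E : Finset (Fin n × Fin n)) (v w : Fin n)
    (j : Fin q) :
    colExp E (fun τ => (if τ v = j then (1 : ℝ) else 0) * if τ w = j then (1 : ℝ) else 0) ≤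
      ((q : ℝ))⁻¹ ^ 2 + if w ∈ cluster E v then 1 else 0 := by
  have h := colExp_forall_eq hq E {v, w} j
  have hle : ((q : ℝ))⁻¹ ≤ 1 := inv_le_one_of_one_le₀ (by exact_mod_cast hq)
  rw [colExp_congr
    (g := fun τ => if ∀ u ∈ ({v, w} : Finset (Fin n)), τ u = j then (1 : ℝ) else 0), h]
  · split_ifs with hw
    · have : ((q : ℝ))⁻¹ ^ (({v, w} : Finset (Fin n)).image
          fun v => (graphOf E).connectedComponentMk v).card ≤ 1 :=
        pow_le_one₀ (by positivity) hle
      have h2 : 0 ≤ ((q : ℝ))⁻¹ ^ 2 := by positivity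
      linarith
    · rw [Finset.image_insert, Finset.image_singleton, Finset.card_pair, add_zero]
      intro hc
      exact hw (mem_cluster.mpr (SimpleGraph.ConnectedComponent.eq.mp hc))
  · intro τ
    by_cases h1 : τ v = j <;> by_cases h2 : τ w = j <;> simp [h1, h2]

/-- Number of vertices of `D` with colour `j`. -/
noncomputable def colourCount (D : Finset (Fin n)) (j : Fin q) (τ : Conf n q) : ℝ :=
  ∑ v ∈ D, if τ v = j then (1 : ℝ) else 0

lemma colExp_variance_le (hq : 0 < q) (E : Finset (Fin n × Fin n)) (D : Finset (Fin n))
    (j : Fin q) :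
    colExp E (fun τ => (colourCount D j τ - D.card / q) ^ 2) ≤
      ∑ v ∈ D, ((cluster E v).card : ℝ) := by
  have hq0 : (q : ℝ) ≠ 0 := by exact_mod_cast hq.ne'
  have h1 : colExp E (colourCount D j) = D.card / q := by
    unfold colourCount
    rw [colExp_sum, Finset.sum_congr rfl fun v _ => colExp_eq_colour hq E v j, Finset.sum_const,
      nsmul_eq_mul, div_eq_mul_inv]
  have h2 : colExp E (fun τ => colourCount D j τ * colourCount D j τ) ≤
      (D.card / q : ℝ) ^ 2 + ∑ v ∈ D, ((cluster E v).card : ℝ) := by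
    unfold colourCount
    simp_rw [Finset.sum_mul_sum, colExp_sum]
    calc _ ≤ ∑ v ∈ D, ∑ w ∈ D, (((q : ℝ))⁻¹ ^ 2 + if w ∈ cluster E v then (1 : ℝ) else 0) :=
          Finset.sum_le_sum fun v _ => Finset.sum_le_sum fun w _ =>
            colExp_eq_colour_pair_le hq E v w j
      _ = (D.card / q : ℝ) ^ 2 + ∑ v ∈ D, ∑ w ∈ D, (if w ∈ cluster E v then (1 : ℝ) else 0) := by
          simp_rw [Finset.sum_add_distrib, Finset.sum_const, nsmul_eq_mul]
          congr 1
          ring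
      _ ≤ _ := by
          gcongr with v _
          rw [Finset.sum_boole]
          exact_mod_cast Finset.card_le_card fun u hu => (Finset.mem_filter.mp hu).2
  have h3 : colExp E (fun τ => (colourCount D j τ - D.card / q) ^ 2) =
      colExp E (fun τ => (colourCount D j τ * colourCount D j τ +
        -(2 * (D.card / q)) * colourCount D j τ) + (D.card / q : ℝ) ^ 2) :=
    colExp_congr fun τ => by ring
  rw [h3, colExp_add, colExp_add, colExp_mul_left, colExp_const hq, h1]
  linarith

/-- Outside the giant clusters the colours are equidistributed. -/
lemma colExp_exists_deviation_le (hq : 0 < q) (hn : 1 ≤ n) (E : Finset (Fin n × Fin n))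
    (D : Finset (Fin n)) {κ ζ : ℝ} (hζ : 0 < ζ)
    (hD : ∑ v ∈ D, ((cluster E v).card : ℝ) ≤ κ * n ^ 2) :
    colExp E (fun τ : Conf n q => if ∃ j, ζ * n < |colourCount D j τ - D.card / q| then (1 : ℝ)
      else 0) ≤ q * (κ / ζ ^ 2) := by
  have hn0 : (0 : ℝ) < n := by exact_mod_cast hn
  have hone : ∀ j : Fin q, colExp E (fun τ : Conf n q =>
      ((ζ * n) ^ 2)⁻¹ * (colourCount D j τ - D.card / q) ^ 2) ≤ κ / ζ ^ 2 := by
    intro j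
    rw [colExp_mul_left, inv_mul_le_iff₀ (by positivity)]
    refine ((colExp_variance_le hq E D j).trans hD).trans_eq ?_
    field_simp
  calc _ ≤ colExp E (fun τ : Conf n q => ∑ j,
        ((ζ * n) ^ 2)⁻¹ * (colourCount D j τ - D.card / q) ^ 2) := by
        apply colExp_mono
        intro τ _
        have hnn : ∀ j : Fin q, 0 ≤ ((ζ * n) ^ 2)⁻¹ * (colourCount D j τ - D.card / q) ^ 2 :=
          fun j => by positivity
        split_ifs with h
        · obtain ⟨j, hj⟩ := h
          refine le_trans ?_ (Finset.single_le_sum (fun j _ => hnn j) (Finset.mem_univ j))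
          rw [le_inv_mul_iff₀ (by positivity), mul_one, ← sq_abs (_ - _)]
          gcongr
        · exact Finset.sum_nonneg fun j _ => hnn j
    _ ≤ ∑ _j : Fin q, κ / ζ ^ 2 := by
        rw [colExp_sum]
        exact Finset.sum_le_sum fun j _ => hone j
    _ = _ := by rw [Finset.sum_const, Finset.card_univ, Fintype.card_fin, nsmul_eq_mul]

end colouring

section onestep
variable {n q : ℕ}

/-- The colour fractions of `X` are, up to `η`, those obtained by giving a single colour to a
fraction `s` of the vertices and splitting the others evenly. -/
def Near (η s : ℝ) (X : Conf n q) : Prop :=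
  ∃ j₀, |cntFrac X j₀ - (s + (1 - s) / q)| ≤ η ∧ ∀ j ≠ j₀, |cntFrac X j - (1 - s) / q| ≤ η

/-- Total predicted fraction of vertices in giant clusters. -/
noncomputable def giantSum (β : ℝ) (X : Conf n q) : ℝ := ∑ i, giantMass β (cntFrac X i)

lemma cntN_eq_colourCount (X : Conf n q) (j : Fin q) :
    (cntN X j : ℝ) = colourCount Finset.univ j X := by
  rw [colourCount, Finset.sum_boole, cntN]

lemma near_of_mono_of_deviation_le (hq : 0 < q) (hn : 1 ≤ n) {M : Finset (Fin n)} {η ζ s : ℝ}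
    (hM : |(M.card : ℝ) / n - s| ≤ η) {τ : Conf n q} {j₀ : Fin q} (hj₀ : ∀ v ∈ M, τ v = j₀)
    (hdev : ∀ j, |colourCount Mᶜ j τ - (Mᶜ.card : ℝ) / q| ≤ ζ * n) : Near (η + ζ) s τ := by
  have hn0 : (0 : ℝ) < n := by exact_mod_cast hn
  have hq0 : (0 : ℝ) < q := by exact_mod_cast hq
  have hq1 : (1 : ℝ) ≤ q := by exact_mod_cast hq
  have hcard : (Mᶜ.card : ℝ) = n - M.card := by
    rw [Finset.card_compl, Fintype.card_fin, Nat.cast_sub]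
    simpa using Finset.card_le_univ M
  set l : ℝ := (M.card : ℝ) / n with hl
  have hfrac : ∀ j, cntFrac τ j = (if j = j₀ then l else 0) + colourCount Mᶜ j τ / n := by
    intro j
    have h1 : colourCount M j τ = if j = j₀ then (M.card : ℝ) else 0 := by
      rw [colourCount, Finset.sum_congr rfl
        (g := fun _ => if j = j₀ then (1 : ℝ) else 0) fun v hv => by
          rw [hj₀ v hv]; exact if_congr eq_comm rfl rfl]
      split_ifs <;> simp
    rw [cntFrac, cntN_eq_colourCount, colourCount, ← Finset.sum_add_sum_compl M, add_div]
    rw [colourCount] at h1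
    rw [h1]
    congr 1
    split_ifs <;> simp [hl]
  have hdev' : ∀ j, |colourCount Mᶜ j τ / n - (1 - l) / q| ≤ ζ := by
    intro j
    have h2 : colourCount Mᶜ j τ / n - (1 - l) / q =
        (colourCount Mᶜ j τ - (Mᶜ.card : ℝ) / q) / n := by
      rw [hcard, hl]
      field_simp
    rw [h2, abs_div, abs_of_pos hn0, div_le_iff₀ hn0]
    exact hdev j
  have hM' := abs_le.mp hM
  have hsplit : |(l - s) / q| ≤ η := by
    rw [abs_div, abs_of_pos hq0, div_le_iff₀ hq0]
    have : 0 ≤ η := (abs_nonneg _).trans hM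
    nlinarith
  have hsplit2 : |(l - s) * (1 - 1 / q)| ≤ η := by
    rw [abs_mul]
    have h3 : |1 - 1 / (q : ℝ)| ≤ 1 := by
      have : 1 / (q : ℝ) ≤ 1 := by rw [div_le_one hq0]; exact hq1
      have : 0 ≤ 1 / (q : ℝ) := by positivity
      rw [abs_le]
      constructor <;> linarith
    calc _ ≤ |l - s| * 1 := by gcongr
      _ ≤ η := by rwa [mul_one]
  refine ⟨j₀, ?_, fun j hj => ?_⟩
  · rw [hfrac, if_pos rfl]
    have h4 : l + colourCount Mᶜ j₀ τ / n - (s + (1 - s) / q) =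
        (l - s) * (1 - 1 / q) + (colourCount Mᶜ j₀ τ / n - (1 - l) / q) := by
      field_simp
      ring
    rw [h4]
    exact (abs_add_le _ _).trans (add_le_add hsplit2 (hdev' j₀))
  · rw [hfrac, if_neg hj]
    have h4 : 0 + colourCount Mᶜ j τ / n - (1 - s) / q =
        -((l - s) / q) + (colourCount Mᶜ j τ / n - (1 - l) / q) := by
      field_simp
      ring
    rw [h4]
    refine (abs_add_le _ _).trans (add_le_add ?_ (hdev' j))
    rwa [abs_neg]

lemma colExp_near_ge {β η ζ : ℝ} (hq : 0 < q) (hn : 1 ≤ n) (hζ : 0 < ζ) (σ : Conf n q)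
    {E : Finset (Fin n × Fin n)} (hgood : ∀ i, GoodClass β η σ i E) :
    ((q : ℝ))⁻¹ ^ q - q * (q * η / ζ ^ 2) ≤
        colExp E (fun τ : Conf n q => if Near (q * η + ζ) (giantSum β σ) τ then (1 : ℝ) else 0) ∧
      ((∀ i j, 1 < β * cntFrac σ i → 1 < β * cntFrac σ j → i = j) →
        1 - q * (q * η / ζ ^ 2) ≤ colExp E
          (fun τ : Conf n q => if Near (q * η + ζ) (giantSum β σ) τ then (1 : ℝ) else 0)) := by
  have hn0 : (0 : ℝ) < n := by exact_mod_cast hn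
  have hq0 : (0 : ℝ) < q := by exact_mod_cast hq
  choose L hLcl hLsub hLcard hLsum hLsub1 using hgood
  set M := Finset.univ.biUnion L with hM
  have hMcard : (M.card : ℝ) = ∑ i, ((L i).card : ℝ) := by
    rw [hM, Finset.card_biUnion]
    · push_cast
      rfl
    · intro i _ j _ hij
      refine Finset.disjoint_left.mpr ?_
      intro v hv hv'
      exact hij ((mem_spinSet.mp (hLsub i hv)).symm.trans (mem_spinSet.mp (hLsub j hv')))
  have hMs : |(M.card : ℝ) / n - giantSum β σ| ≤ q * η := by
    rw [hMcard, giantSum, Finset.sum_div, ← Finset.sum_sub_distrib]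
    calc _ ≤ ∑ i : Fin q, |((L i).card : ℝ) / n - giantMass β (cntFrac σ i)| :=
          Finset.abs_sum_le_sum_abs _ _
      _ ≤ ∑ _i : Fin q, η := Finset.sum_le_sum fun i _ => hLcard i
      _ = q * η := by rw [Finset.sum_const, Finset.card_univ, Fintype.card_fin, nsmul_eq_mul]
  have hsum : ∑ v ∈ Mᶜ, ((cluster E v).card : ℝ) ≤ q * η * n ^ 2 := by
    rw [← Finset.sum_fiberwise Mᶜ σ]
    calc _ ≤ ∑ _i : Fin q, η * (n : ℝ) ^ 2 := by
          apply Finset.sum_le_sum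
          intro i _
          refine le_trans (Finset.sum_le_sum_of_subset_of_nonneg ?_ fun _ _ _ => ?_) (hLsum i)
          · intro v hv
            rw [Finset.mem_filter, Finset.mem_compl] at hv
            refine Finset.mem_sdiff.mpr ⟨mem_spinSet.mpr hv.2, fun h => hv.1 ?_⟩
            exact Finset.mem_biUnion.mpr ⟨i, Finset.mem_univ i, h⟩
          · positivity
      _ = _ := by
          rw [Finset.sum_const, Finset.card_univ, Fintype.card_fin, nsmul_eq_mul, mul_assoc]
  have hdev := colExp_exists_deviation_le hq hn E Mᶜ hζ hsum
  have hmain : colExp E (fun τ : Conf n q => if ∃ j₀, ∀ v ∈ M, τ v = j₀ then (1 : ℝ) else 0) -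
      q * (q * η / ζ ^ 2) ≤
      colExp E (fun τ : Conf n q => if Near (q * η + ζ) (giantSum β σ) τ then (1 : ℝ) else 0) := by
    rw [sub_le_iff_le_add]
    refine le_trans ?_ (add_le_add_right hdev _)
    rw [← colExp_add]
    apply colExp_mono
    intro τ _
    by_cases hm : ∃ j₀, ∀ v ∈ M, τ v = j₀
    · by_cases hd : ∃ j, ζ * n < |colourCount Mᶜ j τ - (Mᶜ.card : ℝ) / q|
      · rw [if_pos hm, if_pos hd]
        split_ifs <;> norm_num
      · obtain ⟨j₀, hj₀⟩ := hm
        rw [if_pos ⟨j₀, hj₀⟩, if_neg hd, if_pos, add_zero]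
        push Not at hd
        exact near_of_mono_of_deviation_le hq hn hMs hj₀ hd
    · rw [if_neg hm]
      split_ifs <;> norm_num
  constructor
  · refine le_trans (sub_le_sub_right ?_ _) hmain
    have hle : ((q : ℝ))⁻¹ ≤ 1 := inv_le_one_of_one_le₀ (by exact_mod_cast hq)
    have hcc : (M.image fun v => (graphOf E).connectedComponentMk v).card ≤ q := by
      rw [hM, Finset.biUnion_image]
      refine (Finset.card_biUnion_le_card_mul _ _ 1 fun i _ => ?_).trans (by simp)
      rcases hLcl i with h | ⟨v, h⟩
      · rw [h]
        simp
      · rw [Finset.card_le_one]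
        intro a ha b hb
        obtain ⟨u, hu, rfl⟩ := Finset.mem_image.mp ha
        obtain ⟨w, hw, rfl⟩ := Finset.mem_image.mp hb
        rw [h, mem_cluster] at hu hw
        exact SimpleGraph.ConnectedComponent.eq.mpr (hu.symm.trans hw)
    calc ((q : ℝ))⁻¹ ^ q ≤
          ((q : ℝ))⁻¹ ^ (M.image fun v => (graphOf E).connectedComponentMk v).card :=
          pow_le_pow_of_le_one (by positivity) hle hcc
      _ = _ := (colExp_forall_eq hq E M ⟨0, hq⟩).symm
      _ ≤ _ := by
          apply colExp_mono
          intro τ _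
          split_ifs with h1 h2
          · exact le_rfl
          · exact absurd ⟨_, h1⟩ h2
          · norm_num
          · exact le_rfl
  · intro huniq
    refine le_trans (sub_le_sub_right ?_ _) hmain
    refine (colExp_one hq E).symm.trans_le (colExp_mono fun τ hτ => ?_)
    refine (if_pos ?_).ge
    rcases M.eq_empty_or_nonempty with h | ⟨v, hv⟩
    · exact ⟨⟨0, hq⟩, by simp [h]⟩
    · refine ⟨τ v, fun w hw => ?_⟩
      obtain ⟨i, -, hi⟩ := Finset.mem_biUnion.mp hv
      obtain ⟨k, -, hk⟩ := Finset.mem_biUnion.mp hw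
      have hsup : ∀ i v, v ∈ L i → 1 < β * cntFrac σ i := by
        intro i v hv
        by_contra hle
        rw [hLsub1 i (not_lt.mp hle)] at hv
        exact Finset.notMem_empty v hv
      obtain rfl := huniq i k (hsup i v hi) (hsup k w hk)
      rcases hLcl i with h | ⟨u, h⟩
      · rw [h] at hi
        exact absurd hi (Finset.notMem_empty v)
      · rw [h, mem_cluster] at hi hk
        exact hτ _ _ (hk.symm.trans hi)

/-- One step of the dynamics sends `σ` close to the configuration predicted by its giants, with
probability bounded below, and with high probability if at most one class is supercritical. -/
lemma exists_one_step_near {β ζ ρ : ℝ} (hβ : 0 < β) (hq : 0 < q) (hζ : 0 < ζ) (hρ : 0 < ρ) :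
    ∃ N₀ : ℕ, ∀ n : ℕ, N₀ ≤ n → 1 ≤ n → ∀ σ : Conf n q,
      ((q : ℝ))⁻¹ ^ q - ρ ≤
        ∑ τ, swStep n q β σ τ * (if Near ζ (giantSum β σ) τ then (1 : ℝ) else 0) ∧
      ((∀ i j, 1 < β * cntFrac σ i → 1 < β * cntFrac σ j → i = j) → 1 - ρ ≤
        ∑ τ, swStep n q β σ τ * (if Near ζ (giantSum β σ) τ then (1 : ℝ) else 0)) := by
  have hq0 : (0 : ℝ) < q := by exact_mod_cast hq
  set η := min (ζ / (2 * q)) (min (ρ * ζ ^ 2 / (8 * q ^ 2)) (ρ / (2 * q))) with hη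
  have hη0 : 0 < η := by positivity
  have hη1 : q * η ≤ ζ / 2 := by
    have : η ≤ ζ / (2 * q) := min_le_left _ _
    rw [le_div_iff₀ (by positivity)] at this
    linarith
  have hη2 : q * (q * η / (ζ / 2) ^ 2) ≤ ρ / 2 := by
    have : η ≤ ρ * ζ ^ 2 / (8 * q ^ 2) := (min_le_right _ _).trans (min_le_left _ _)
    rw [le_div_iff₀ (by positivity)] at this
    rw [← mul_div_assoc, div_le_iff₀ (by positivity)]
    linarith
  have hη3 : q * η ≤ ρ / 2 := by
    have : η ≤ ρ / (2 * q) := (min_le_right _ _).trans (min_le_right _ _)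
    rw [le_div_iff₀ (by positivity)] at this
    linarith
  obtain ⟨N₀, hN₀⟩ := exists_forall_percProb_not_goodClass_le hβ hη0 q
  refine ⟨N₀, fun n hn hn1 σ => ?_⟩
  obtain ⟨h0, h1⟩ := edge_prob_bounds hβ n
  rw [sum_swStep_mul]
  have hfail : percProb (Real.exp (-(β / n))) (monoPairs σ)
      (fun E => ∃ i, ¬ GoodClass β η σ i E) ≤ ρ / 2 := by
    refine (percProb_exists_le h0 h1 fun i E => ¬ GoodClass β η σ i E).trans ?_
    calc _ ≤ ∑ _i : Fin q, η := Finset.sum_le_sum fun i _ => hN₀ n hn hn1 σ i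
      _ = q * η := by rw [Finset.sum_const, Finset.card_univ, Fintype.card_fin, nsmul_eq_mul]
      _ ≤ ρ / 2 := hη3
  have hmono : ∀ E, colExp E (fun τ : Conf n q =>
      if Near (q * η + ζ / 2) (giantSum β σ) τ then (1 : ℝ) else 0) ≤
      colExp E (fun τ : Conf n q => if Near ζ (giantSum β σ) τ then (1 : ℝ) else 0) := by
    intro E
    apply colExp_mono
    intro τ _
    split_ifs with ha hb
    · exact le_rfl
    · obtain ⟨j₀, hj, hj'⟩ := ha
      exact absurd ⟨j₀, by linarith, fun j hne => by linarith [hj' j hne]⟩ hb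
    · norm_num
    · exact le_rfl
  have hgen : ∀ p : ℝ, p ≤ 1 → (∀ E, (∀ i, GoodClass β η σ i E) → p - q * (q * η / (ζ / 2) ^ 2) ≤
      colExp E (fun τ : Conf n q =>
        if Near (q * η + ζ / 2) (giantSum β σ) τ then (1 : ℝ) else 0)) →
      p - ρ ≤ perc (Real.exp (-(β / n))) (monoPairs σ) fun E =>
        colExp E (fun τ : Conf n q => if Near ζ (giantSum β σ) τ then (1 : ℝ) else 0) := by
    intro p hp hE
    have hpt : perc (Real.exp (-(β / n))) (monoPairs σ) (fun E => (p - ρ / 2) +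
        -1 * (if ∃ i, ¬ GoodClass β η σ i E then (1 : ℝ) else 0)) ≤
        perc (Real.exp (-(β / n))) (monoPairs σ) fun E =>
        colExp E (fun τ : Conf n q => if Near ζ (giantSum β σ) τ then (1 : ℝ) else 0) := by
      apply perc_mono h0 h1
      intro E _
      by_cases hg : ∃ i, ¬ GoodClass β η σ i E
      · rw [if_pos hg]
        have h2 : 0 ≤ colExp E (fun τ : Conf n q =>
            if Near ζ (giantSum β σ) τ then (1 : ℝ) else 0) :=
          (colExp_const hq E 0).symm.trans_le
            (colExp_mono fun τ _ => by split_ifs <;> norm_num)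
        linarith
      · rw [if_neg hg]
        push Not at hg
        have := hE E hg
        have := hmono E
        linarith
    rw [perc_add, perc_mul_left, perc_const] at hpt
    have hfail' : perc (Real.exp (-(β / n))) (monoPairs σ)
        (fun E => if ∃ i, ¬ GoodClass β η σ i E then (1 : ℝ) else 0) ≤ ρ / 2 := by
      convert hfail using 2
      rw [percProb]
      congr! 2 with E
      by_cases h : ∃ i, ¬ GoodClass β η σ i E
      · rw [if_pos h, if_pos h]
      · rw [if_neg h, if_neg h]
    linarith
  constructor
  · apply hgen _ (pow_le_one₀ (by positivity) (inv_le_one_of_one_le₀ (by exact_mod_cast hq)))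
    intro E hE
    exact (colExp_near_ge hq hn1 (by positivity) σ hE).1
  · intro huniq
    apply hgen _ le_rfl
    intro E hE
    exact (colExp_near_ge hq hn1 (by positivity) σ hE).2 huniq

end onestep

section dynamics
variable {n q : ℕ}

/-- Expectation of `f` after one step of the dynamics, as a function of the current state. -/
noncomputable def stepExp (β : ℝ) (f : Conf n q → ℝ) (σ : Conf n q) : ℝ :=
  ∑ τ, swStep n q β σ τ * f τ

/-- Indicator function of a set of configurations. -/
noncomputable def confInd (P : Conf n q → Prop) (τ : Conf n q) : ℝ := if P τ then 1 else 0

lemma confInd_nonneg (P : Conf n q → Prop) (τ : Conf n q) : 0 ≤ confInd P τ := by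
  unfold confInd
  split_ifs <;> norm_num

lemma confInd_mono {P Q : Conf n q → Prop} (h : ∀ τ, P τ → Q τ) (τ : Conf n q) :
    confInd P τ ≤ confInd Q τ := by
  unfold confInd
  split_ifs with h1 h2
  · exact le_rfl
  · exact absurd (h τ h1) h2
  · norm_num
  · exact le_rfl

lemma sum_swProb_mul (β : ℝ) (t : ℕ) (σ : Conf n q) (f : Conf n q → ℝ) :
    ∑ τ, swProb n q β t σ τ * f τ = (stepExp β)^[t] f σ := by
  induction t generalizing σ with
  | zero => simp [swProb]
  | succ t ih =>
    rw [Function.iterate_succ_apply', stepExp]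
    simp_rw [← ih, swProb, Finset.sum_mul, Finset.mul_sum]
    rw [Finset.sum_comm]
    simp_rw [mul_assoc]

lemma stepExp_mono {β : ℝ} (hβ : 0 < β) {f g : Conf n q → ℝ} (h : ∀ τ, f τ ≤ g τ)
    (σ : Conf n q) : stepExp β f σ ≤ stepExp β g σ :=
  Finset.sum_le_sum fun τ _ => mul_le_mul_of_nonneg_left (h τ) (swStep_nonneg hβ σ τ)

lemma stepExp_affine (hq : 0 < q) (β a b : ℝ) (f : Conf n q → ℝ) (σ : Conf n q) :
    stepExp β (fun τ => a + b * f τ) σ = a + b * stepExp β f σ := by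
  have h1 : ∑ τ, swStep n q β σ τ * 1 = 1 := by
    rw [sum_swStep_mul]
    simp_rw [colExp_one hq]
    exact perc_one
  unfold stepExp
  simp_rw [mul_add, Finset.sum_add_distrib, mul_left_comm _ b, ← Finset.mul_sum]
  rw [← Finset.sum_mul]
  simp only [mul_one] at h1
  rw [h1, one_mul]

lemma iterate_stepExp_mono {β : ℝ} (hβ : 0 < β) (t : ℕ) {f g : Conf n q → ℝ}
    (h : ∀ τ, f τ ≤ g τ) (σ : Conf n q) : (stepExp β)^[t] f σ ≤ (stepExp β)^[t] g σ := by
  induction t generalizing σ with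
  | zero => exact h σ
  | succ t ih =>
    rw [Function.iterate_succ_apply', Function.iterate_succ_apply']
    exact stepExp_mono hβ ih σ

lemma iterate_stepExp_affine (hq : 0 < q) (β a b : ℝ) (t : ℕ) (f : Conf n q → ℝ)
    (σ : Conf n q) :
    (stepExp β)^[t] (fun τ => a + b * f τ) σ = a + b * (stepExp β)^[t] f σ := by
  induction t generalizing σ with
  | zero => rfl
  | succ t ih =>
    rw [Function.iterate_succ_apply', Function.iterate_succ_apply', funext ih]
    exact stepExp_affine hq β a b _ σ

lemma iterate_stepExp_nonneg {β : ℝ} (hβ : 0 < β) (hq : 0 < q) (t : ℕ) {f : Conf n q → ℝ}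
    (h : ∀ τ, 0 ≤ f τ) (σ : Conf n q) : 0 ≤ (stepExp β)^[t] f σ := by
  have := iterate_stepExp_affine hq β 0 0 t f σ
  simp only [zero_mul, zero_add] at this
  rw [← this]
  exact iterate_stepExp_mono hβ t h σ

/-- If `P` is reached in one step with probability at least `1 - ρ`, and `f` has expectation at
least `1 - ρ'` after `t` steps from `P`, then the losses add up. -/
lemma le_iterate_stepExp_of_confInd {β ρ ρ' : ℝ} (hβ : 0 < β) (hq : 0 < q) (k t : ℕ)
    {f : Conf n q → ℝ} (hf : ∀ τ, 0 ≤ f τ) {P : Conf n q → Prop} {σ : Conf n q} (hρ' : 0 ≤ ρ')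
    (h1 : 1 - ρ ≤ (stepExp β)^[k] (confInd P) σ)
    (h2 : ∀ τ, P τ → 1 - ρ' ≤ (stepExp β)^[t] f τ) :
    1 - (ρ + ρ') ≤ (stepExp β)^[k + t] f σ := by
  rw [Function.iterate_add_apply]
  have h3 := iterate_stepExp_mono hβ k (f := fun τ => -ρ' + 1 * confInd P τ)
    (g := (stepExp β)^[t] f) (fun τ => ?_) σ
  · rw [iterate_stepExp_affine hq] at h3
    linarith
  · have h4 := iterate_stepExp_nonneg hβ hq t hf τ
    unfold confInd
    split_ifs with h
    · linarith [h2 τ h]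
    · linarith

lemma cntFrac_nonneg (X : Conf n q) (j : Fin q) : 0 ≤ cntFrac X j := by
  unfold cntFrac
  positivity

lemma sum_cntFrac (hn : 1 ≤ n) (X : Conf n q) : ∑ j, cntFrac X j = 1 := by
  have hn0 : (n : ℝ) ≠ 0 := by positivity
  have h : ∑ j, cntN X j = n := by
    have := Finset.card_eq_sum_card_fiberwise (s := Finset.univ) (t := Finset.univ) (f := X)
      fun _ _ => Finset.mem_coe.mpr (Finset.mem_univ _)
    rw [Finset.card_univ, Fintype.card_fin] at this
    exact this.symm
  unfold cntFrac
  rw [← Finset.sum_div, ← Nat.cast_sum, h, div_self hn0]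

lemma giantSum_mem_Icc {β s₁ : ℝ} (hβ : 0 < β) (hn : 1 ≤ n)
    (hbound : ∀ x : Fin q → ℝ, (∀ i, 0 ≤ x i) → ∑ i, x i = 1 → s₁ ≤ ∑ i, giantMass β (x i))
    (X : Conf n q) : giantSum β X ∈ Set.Icc s₁ 1 := by
  refine ⟨hbound _ (cntFrac_nonneg X) (sum_cntFrac hn X), ?_⟩
  rw [← sum_cntFrac hn X]
  exact Finset.sum_le_sum fun i _ => giantMass_le_self hβ (cntFrac_nonneg X i)

lemma Near.trans {η ζ s t : ℝ} {X : Conf n q} (hq : 0 < q) (h : Near η s X) (hst : |s - t| ≤ ζ) :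
    Near (η + ζ) t X := by
  have hq1 : (1 : ℝ) ≤ q := by exact_mod_cast hq
  have hq0 : (0 : ℝ) < q := by linarith
  have hi0 : 0 ≤ 1 / (q : ℝ) := by positivity
  have hi : 1 / (q : ℝ) ≤ 1 := by rwa [div_le_one hq0]
  have hb : ∀ c : ℝ, |c| ≤ 1 → |c * (s - t)| ≤ ζ := by
    intro c hc
    rw [abs_mul]
    calc _ ≤ 1 * |s - t| := by gcongr
      _ ≤ ζ := by rwa [one_mul]
  obtain ⟨j₀, hj₀, hj⟩ := h
  refine ⟨j₀, ?_, fun j hne => ?_⟩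
  · have e : cntFrac X j₀ - (t + (1 - t) / q) =
        (cntFrac X j₀ - (s + (1 - s) / q)) + (1 - 1 / q) * (s - t) := by ring
    rw [e]
    refine (abs_add_le _ _).trans (add_le_add hj₀ (hb _ ?_))
    rw [abs_le]
    constructor <;> linarith
  · have e : cntFrac X j - (1 - t) / q =
        (cntFrac X j - (1 - s) / q) + (-(1 / q)) * (s - t) := by ring
    rw [e]
    refine (abs_add_le _ _).trans (add_le_add (hj j hne) (hb _ ?_))
    rw [abs_le]
    constructor <;> linarith

lemma Near.mono {η ζ s : ℝ} {X : Conf n q} (hq : 0 < q) (h : Near η s X) (hηζ : η ≤ ζ) :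
    Near ζ s X := by
  have := h.trans hq (t := s) (ζ := ζ - η) (by simpa using hηζ)
  rwa [add_sub_cancel] at this

lemma mul_cntFrac_le_one {β η s s₁ : ℝ} (hβ : 0 < β) (hq : 0 < q)
    (hη : η ≤ 1 / β - (1 - s₁) / q) (hs : s₁ ≤ s) {X : Conf n q} {j : Fin q}
    (hj : |cntFrac X j - (1 - s) / q| ≤ η) : β * cntFrac X j ≤ 1 := by
  have hq0 : (0 : ℝ) < q := by exact_mod_cast hq
  have h1 : (1 - s) / q ≤ (1 - s₁) / q := by gcongr
  have h2 : cntFrac X j ≤ 1 / β := by linarith [(abs_le.mp hj).2]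
  rw [le_div_iff₀ hβ] at h2
  linarith

lemma Near.supercritical_unique {β η s s₁ : ℝ} (hβ : 0 < β) (hq : 0 < q)
    (hη : η ≤ 1 / β - (1 - s₁) / q) (hs : s₁ ≤ s) {X : Conf n q} (h : Near η s X)
    (i j : Fin q) (hi : 1 < β * cntFrac X i) (hj : 1 < β * cntFrac X j) : i = j := by
  obtain ⟨j₀, -, h⟩ := h
  have : ∀ i, 1 < β * cntFrac X i → i = j₀ := by
    intro i hi
    by_contra hne
    exact absurd (mul_cntFrac_le_one hβ hq hη hs (h i hne)) (not_le.mpr hi)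
  rw [this i hi, this j hj]

lemma Near.abs_giantSum_sub_driftMass_le {β η s s₁ : ℝ} (hβ : 0 < β) (hq : 0 < q)
    (hη : η ≤ 1 / β - (1 - s₁) / q) (hs : s₁ ≤ s) {X : Conf n q} (h : Near η s X) :
    |giantSum β X - driftMass q β s| ≤ 2 * η := by
  have hq0 : (0 : ℝ) < q := by exact_mod_cast hq
  obtain ⟨j₀, hj₀, h⟩ := h
  have h1 : giantSum β X = giantMass β (cntFrac X j₀) := by
    apply Finset.sum_eq_single j₀
    · intro j _ hne
      exact giantMass_eq_zero (mul_cntFrac_le_one hβ hq hη hs (h j hne))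
    · simp
  have h2 : (1 + ((q : ℝ) - 1) * s) / q = s + (1 - s) / q := by
    field_simp
    ring
  rw [h1, driftMass, h2]
  exact (abs_giantMass_sub_le hβ _ _).trans (by linarith)

lemma subcritical_gap_pos {β s₁ : ℝ} (hβ : 0 < β) (hq : 0 < q) (h₁ : 1 - q / β < s₁) :
    0 < 1 / β - (1 - s₁) / q := by
  have hq0 : (0 : ℝ) < q := by exact_mod_cast hq
  rw [sub_pos, div_lt_div_iff₀ hq0 hβ]
  have : 1 - s₁ < q / β := by linarith
  rw [lt_div_iff₀ hβ] at this
  linarith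

lemma exists_near_iterate_driftMass {β s₁ : ℝ} (hq : 2 ≤ q) (hβ : (q : ℝ) < β)
    (h₁ : 1 - q / β < s₁)
    (hbound : ∀ x : Fin q → ℝ, (∀ i, 0 ≤ x i) → ∑ i, x i = 1 → s₁ ≤ ∑ i, giantMass β (x i))
    {ε : ℝ} (hε : 0 < ε) (t : ℕ) : ∀ ρ > 0, ∃ η > 0, ∃ N : ℕ, ∀ n ≥ N,
      ∀ s ∈ Set.Icc s₁ 1, ∀ X : Conf n q, Near η s X →
        1 - ρ ≤ (stepExp β)^[t] (confInd (Near ε ((driftMass q β)^[t] s))) X := by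
  have hq0 : 0 < q := by omega
  have hβ0 : 0 < β := lt_trans (by exact_mod_cast hq0) hβ
  induction t with
  | zero =>
    intro ρ hρ
    refine ⟨ε, hε, 0, fun n _ s _ X hX => ?_⟩
    rw [Function.iterate_zero_apply, Function.iterate_zero_apply, confInd, if_pos hX]
    linarith
  | succ t ih =>
    intro ρ hρ
    obtain ⟨η', hη', N', hN'⟩ := ih (ρ / 2) (half_pos hρ)
    obtain ⟨N, hN⟩ := exists_one_step_near hβ0 hq0 (half_pos hη') (half_pos hρ)
    refine ⟨min (η' / 4) (1 / β - (1 - s₁) / q), lt_min (by positivity)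
      (subcritical_gap_pos hβ0 hq0 h₁), max (max N N') 1, fun n hn s hs X hX => ?_⟩
    have hn1 : 1 ≤ n := (le_max_right _ _).trans hn
    have hnN : N ≤ n := (le_max_left _ _).trans ((le_max_left _ _).trans hn)
    have hnN' : N' ≤ n := (le_max_right _ _).trans ((le_max_left _ _).trans hn)
    have hstep := (hN n hnN hn1 X).2
      (hX.supercritical_unique hβ0 hq0 (min_le_right _ _) hs.1)
    have hdrift := hX.abs_giantSum_sub_driftMass_le hβ0 hq0 (min_le_right _ _) hs.1
    have hmin : min (η' / 4) (1 / β - (1 - s₁) / q) ≤ η' / 4 := min_le_left _ _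
    rw [Function.iterate_succ_apply (driftMass q β), add_comm t 1, ← add_halves ρ]
    refine le_iterate_stepExp_of_confInd hβ0 hq0 1 t (confInd_nonneg _) (half_pos hρ).le
      (P := Near η' (driftMass q β s)) ?_ (hN' n hnN' _ (driftMass_mem_Icc hq hβ h₁ hbound hs))
    refine hstep.trans (stepExp_mono hβ0 (f := confInd (Near (η' / 2) (giantSum β X)))
      (confInd_mono fun τ hτ => ?_) X)
    exact (hτ.trans hq0 hdrift).mono hq0 (by linarith)

/-- After sufficiently many steps, the dynamics is with high probability close to a configuration
with a single giant colour class. -/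
lemma exists_iterate_stepExp_near_ge {β s₁ η ρ : ℝ} (hq : 2 ≤ q) (hβ : (q : ℝ) < β)
    (h₁ : 1 - q / β < s₁)
    (hbound : ∀ x : Fin q → ℝ, (∀ i, 0 ≤ x i) → ∑ i, x i = 1 → s₁ ≤ ∑ i, giantMass β (x i))
    (hη : 0 < η) (hρ : 0 < ρ) : ∃ k N : ℕ, ∀ n ≥ N, ∀ X : Conf n q,
      1 - ρ ≤ (stepExp β)^[k] (confInd fun τ => ∃ s ∈ Set.Icc s₁ 1, Near η s τ) X := by
  have hq0 : 0 < q := by omega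
  have hβ0 : 0 < β := lt_trans (by exact_mod_cast hq0) hβ
  wlog hη' : η ≤ 1 / β - (1 - s₁) / q generalizing η
  · obtain ⟨k, N, h⟩ := this (subcritical_gap_pos hβ0 hq0 h₁) le_rfl
    refine ⟨k, N, fun n hn X => (h n hn X).trans (iterate_stepExp_mono hβ0 k
      (confInd_mono ?_) X)⟩
    rintro τ ⟨s, hs, hτ⟩
    exact ⟨s, hs, hτ.mono hq0 (not_le.mp hη').le⟩
  set c : ℝ := ((q : ℝ))⁻¹ ^ q with hc
  have hc0 : 0 < c := by positivity
  have hc1 : c ≤ 1 :=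
    pow_le_one₀ (by positivity) (inv_le_one_of_one_le₀ (by exact_mod_cast hq0))
  obtain ⟨k, hk⟩ := exists_pow_lt_of_lt_one (half_pos hρ) (show 1 - c < 1 by linarith)
  set ξ : ℝ := ρ / (2 * (k + 1)) with hξ
  have hξ0 : 0 < ξ := by positivity
  have hkξ : k * ξ ≤ ρ / 2 := by
    have : (k + 1) * ξ = ρ / 2 := by
      rw [hξ]
      field_simp
    nlinarith
  obtain ⟨N, hN⟩ := exists_one_step_near hβ0 hq0 hη hξ0
  refine ⟨k, max N 1, fun n hn X => ?_⟩
  have hn1 : 1 ≤ n := (le_max_right _ _).trans hn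
  set G : Conf n q → Prop := fun τ => ∃ s ∈ Set.Icc s₁ 1, Near η s τ with hG
  have hle : ∀ σ : Conf n q, stepExp β (confInd (Near η (giantSum β σ))) σ ≤
      stepExp β (confInd G) σ := fun σ =>
    stepExp_mono hβ0 (confInd_mono fun τ hτ => ⟨_, giantSum_mem_Icc hβ0 hn1 hbound σ, hτ⟩) σ
  have hstep : ∀ σ : Conf n q, (c - ξ) + (1 - c) * confInd G σ ≤ stepExp β (confInd G) σ := by
    intro σ
    obtain ⟨ha, hb⟩ := hN n ((le_max_left _ _).trans hn) hn1 σ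
    refine le_trans ?_ (hle σ)
    by_cases hσ : G σ
    · rw [confInd, if_pos hσ]
      obtain ⟨s, hs, hσ⟩ := hσ
      have : 1 - ξ ≤ stepExp β (confInd (Near η (giantSum β σ))) σ :=
        hb (hσ.supercritical_unique hβ0 hq0 hη' hs.1)
      linarith
    · rw [confInd, if_neg hσ]
      have : c - ξ ≤ stepExp β (confInd (Near η (giantSum β σ))) σ := ha
      linarith
  have hiter : ∀ (m : ℕ) (σ : Conf n q),
      1 - (1 - c) ^ m - m * ξ ≤ (stepExp β)^[m] (confInd G) σ := by
    intro m σ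
    induction m with
    | zero => simpa using confInd_nonneg G σ
    | succ m ih =>
      rw [Function.iterate_succ_apply]
      have h2 := iterate_stepExp_mono hβ0 m hstep σ
      rw [iterate_stepExp_affine hq0] at h2
      have h3 := mul_le_mul_of_nonneg_left ih (sub_nonneg.mpr hc1)
      have h4 : 0 ≤ c * (m * ξ) := by positivity
      push_cast
      rw [pow_succ]
      nlinarith
  linarith [hiter k X]

lemma abs_sort_rev_sub_le {f : Fin q → ℝ} {b c η : ℝ} {j₀ : Fin q} (hbc : c ≤ b)
    (hj₀ : |f j₀ - b| ≤ η) (hj : ∀ j ≠ j₀, |f j - c| ≤ η) (i : Fin q) :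
    |f (Tuple.sort f i.rev) - if (i : ℕ) = 0 then b else c| ≤ η := by
  have hj₀' := abs_le.mp hj₀
  have hanti : ∀ i i' : Fin q, i ≤ i' → f (Tuple.sort f i'.rev) ≤ f (Tuple.sort f i.rev) :=
    fun i i' h => Tuple.monotone_sort f (Fin.rev_le_rev.mpr h)
  obtain ⟨k, hk⟩ : ∃ k : Fin q, Tuple.sort f k.rev = j₀ :=
    ⟨((Tuple.sort f).symm j₀).rev, by simp⟩
  have hne : ∀ l : Fin q, l ≠ k → Tuple.sort f l.rev ≠ j₀ := by
    intro l hl h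
    rw [← hk] at h
    exact hl (Fin.rev_injective ((Tuple.sort f).injective h))
  by_cases hi : (i : ℕ) = 0
  · rw [if_pos hi]
    by_cases hik : i = k
    · rwa [hik, hk]
    · have h1 := abs_le.mp (hj _ (hne i hik))
      have h2 := hanti i k (Fin.le_def.mpr (by omega))
      rw [hk] at h2
      rw [abs_le]
      constructor <;> linarith
  · rw [if_neg hi]
    by_cases hik : i = k
    · set z : Fin q := ⟨0, by have := i.isLt; omega⟩ with hz
      have hzk : z ≠ k := by
        intro h
        rw [hik, ← h] at hi
        exact hi rfl
      have h1 := abs_le.mp (hj _ (hne z hzk))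
      have h2 := hanti z k (Fin.le_def.mpr (by simp [hz]))
      rw [hk] at h2
      rw [hik, hk, abs_le]
      constructor <;> linarith
    · exact hj _ (hne i hik)

lemma Near.linf_le {β η s : ℝ} (hq : 2 ≤ q) (hs : 0 ≤ s)
    (ha : aFix q β = (1 + ((q : ℝ) - 1) * s) / q) {X : Conf n q} (h : Near η s X) :
    linf (alphaVec X) (mVec q β) ≤ η := by
  have hq' : (2 : ℝ) ≤ q := by exact_mod_cast hq
  have hq0 : (q : ℝ) ≠ 0 := by linarith
  have hq1 : (q : ℝ) - 1 ≠ 0 := by linarith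
  have : Nonempty (Fin q) := ⟨⟨0, by omega⟩⟩
  obtain ⟨j₀, hj₀, hj⟩ := h
  have e1 : aFix q β = s + (1 - s) / q := by
    rw [ha]
    field_simp
    ring
  have e2 : (1 - aFix q β) / ((q : ℝ) - 1) = (1 - s) / q := by
    rw [ha]
    field_simp
    ring
  refine ciSup_le fun i => ?_
  rw [mVec, kappaVec, alphaVec, e2, e1]
  exact abs_sort_rev_sub_le (by linarith) hj₀ hj i

end dynamics

/-- Lemma 3.1: for any `ε > 0` and `δ ∈ (0,1)` there is a constant
number of steps `T` after which, from any starting configuration, the SW dynamics is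
within `ε` of the majority vector `m` in `ℓ∞`, with probability at least `δ`. -/
theorem sw_constant_distance (q : ℕ) (hq : 2 ≤ q) (β : ℝ) (hβ : (q : ℝ) < β)
    (ε : ℝ) (hε : 0 < ε) (δ : ℝ) (hδ : δ ∈ Set.Ioo (0 : ℝ) 1) :
    ∃ T : ℕ, ∃ N : ℕ, ∀ n : ℕ, N ≤ n → ∀ X₀ : Conf n q,
      δ ≤ ∑ τ : Conf n q,
        (if linf (alphaVec τ) (mVec q β) ≤ ε then swProb n q β T X₀ τ else 0) := by
  have hq0 : 0 < q := by omega
  have hβ0 : 0 < β := lt_trans (by exact_mod_cast hq0) hβ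
  have hρ : 0 < (1 - δ) / 2 := by linarith [hδ.2]
  obtain ⟨s₁, h₁, h₁', hbound⟩ := exists_giantMass_sum_lower_bound hq hβ
  obtain ⟨s, hs0, -, ha, hconv⟩ := exists_iterate_driftMass_close hq hβ h₁ h₁' hbound
  obtain ⟨t, ht⟩ := hconv (ε / 2) (half_pos hε)
  obtain ⟨η, hη, N₁, hN₁⟩ :=
    exists_near_iterate_driftMass hq hβ h₁ hbound (half_pos hε) t _ hρ
  obtain ⟨k, N₂, hN₂⟩ := exists_iterate_stepExp_near_ge hq hβ h₁ hbound hη hρ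
  refine ⟨k + t, max N₁ N₂, fun n hn X₀ => ?_⟩
  have hsum : ∑ τ : Conf n q,
      (if linf (alphaVec τ) (mVec q β) ≤ ε then swProb n q β (k + t) X₀ τ else 0) =
      (stepExp β)^[k + t] (confInd fun τ => linf (alphaVec τ) (mVec q β) ≤ ε) X₀ := by
    rw [← sum_swProb_mul]
    exact Finset.sum_congr rfl fun τ _ => by simp [confInd]
  rw [hsum]
  have key := le_iterate_stepExp_of_confInd hβ0 hq0 k t
    (f := confInd fun τ => linf (alphaVec τ) (mVec q β) ≤ ε) (confInd_nonneg _) hρ.le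
    (hN₂ n ((le_max_right _ _).trans hn) X₀) ?_
  · linarith
  · rintro τ ⟨r, hr, hτ⟩
    refine (hN₁ n ((le_max_left _ _).trans hn) r hr τ hτ).trans
      (iterate_stepExp_mono hβ0 t (confInd_mono fun X hX => ?_) τ)
    exact ((hX.trans hq0 (ht r hr)).mono hq0 (add_halves ε).le).linf_le hq hs0.le ha
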